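/- Let 0 < r₁ < r₃ < r₄ < r₅ < r₂ and T > 0 be real numbers, and let u ∈ C¹((r₁,r₂)×[0,T)) be a classical solution of the radial equation u_t = (φ'(u_r))_r + φ'(u_r)/r on (r₁,r₂)×[0,T) such that |u_r(r₃,0)| < 1, |u_r(r₅,0)| < 1, and u_r(r₄,0) > 1 + (r₂(r₂−r₁)/r₁²)·√(φ'(1)/(2|φ'''(1)|)). Assume moreover that u is of class C³ in r with continuous mixed derivative u_rt on the open set where |u_r| ≠ 1 (as guaranteed by interior parabolic regularity). Then T ≤ r₂(r₂−r₁)/√(2·φ'(1)·|φ'''(1)|). In particular no global-in-time C¹ radial solution exists with such initial data, independently of boundary conditions. -/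

import Mathlib

/-- The largest sum of `n + 1` ordered increments of `y(·, τ)` over subintervals of `[p, x]`. -/
noncomputable def posVar (y : ℝ → ℝ → ℝ) (p q : ℝ) : ℕ → ℝ → ℝ → ℝ
  | 0 => fun x τ => sSup ((fun c => y (min c x) τ) '' Set.Icc p q) - y p τ
  | n + 1 => fun x τ =>
      sSup ((fun P : ℝ × ℝ => posVar y p q n (min P.1 (min P.2 x)) τ + y (min P.2 x) τ
        - y (min P.1 (min P.2 x)) τ) '' (Set.Icc p q ×ˢ Set.Icc p q))

section PosVar

variable {y : ℝ → ℝ → ℝ} {p q : ℝ}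

theorem continuous_posVar (hy : Continuous fun P : ℝ × ℝ => y P.1 P.2) (n : ℕ) :
    Continuous fun P : ℝ × ℝ => posVar y p q n P.1 P.2 := by
  induction n with
  | zero =>
    have h := (isCompact_Icc (a := p) (b := q)).continuous_sSup
      (f := fun (P : ℝ × ℝ) (c : ℝ) => y (min c P.1) P.2)
      (hy.comp (f := fun Q : (ℝ × ℝ) × ℝ => (min Q.2 Q.1.1, Q.1.2)) (by fun_prop))
    exact h.sub (hy.comp (f := fun P : ℝ × ℝ => (p, P.2)) (by fun_prop))
  | succ n ih =>
    have hK := (isCompact_Icc (a := p) (b := q)).prod (isCompact_Icc (a := p) (b := q))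
    refine hK.continuous_sSup
      (f := fun (P : ℝ × ℝ) (Q : ℝ × ℝ) => posVar y p q n (min Q.1 (min Q.2 P.1)) P.2
        + y (min Q.2 P.1) P.2 - y (min Q.1 (min Q.2 P.1)) P.2) ?_
    have h1 := ih.comp (f := fun R : (ℝ × ℝ) × (ℝ × ℝ) =>
      (min R.2.1 (min R.2.2 R.1.1), R.1.2)) (by fun_prop)
    have h2 := hy.comp (f := fun R : (ℝ × ℝ) × (ℝ × ℝ) =>
      (min R.2.1 (min R.2.2 R.1.1), R.1.2)) (by fun_prop)
    have h3 := hy.comp (f := fun R : (ℝ × ℝ) × (ℝ × ℝ) =>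
      (min R.2.2 R.1.1, R.1.2)) (by fun_prop)
    exact (h1.add h3).sub h2

theorem le_posVar_zero (hy : Continuous fun P : ℝ × ℝ => y P.1 P.2) {c x : ℝ} (τ : ℝ)
    (hpc : p ≤ c) (hcx : c ≤ x) (hxq : x ≤ q) : y c τ - y p τ ≤ posVar y p q 0 x τ := by
  have hc : Continuous fun c => y (min c x) τ :=
    hy.comp (f := fun c : ℝ => (min c x, τ)) (by fun_prop)
  have := le_csSup (isCompact_Icc.image hc).bddAbove
    (Set.mem_image_of_mem (fun c => y (min c x) τ) (⟨hpc, hcx.trans hxq⟩ : c ∈ Set.Icc p q))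
  simp only [min_eq_left hcx] at this
  simp only [posVar]
  linarith

theorem exists_posVar_zero (hy : Continuous fun P : ℝ × ℝ => y P.1 P.2) {x : ℝ} (τ : ℝ)
    (hpx : p ≤ x) (hxq : x ≤ q) :
    ∃ c, p ≤ c ∧ c ≤ x ∧ posVar y p q 0 x τ = y c τ - y p τ := by
  have hc : Continuous fun c => y (min c x) τ :=
    hy.comp (f := fun c : ℝ => (min c x, τ)) (by fun_prop)
  obtain ⟨c, hcm, hce⟩ := isCompact_Icc.exists_sSup_image_eq
    (Set.nonempty_Icc.2 (hpx.trans hxq)) hc.continuousOn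
  exact ⟨min c x, le_min hcm.1 hpx, min_le_right _ _, by simp only [posVar, hce]⟩

theorem le_posVar_succ (hy : Continuous fun P : ℝ × ℝ => y P.1 P.2) {n : ℕ} {b c x : ℝ} (τ : ℝ)
    (hpb : p ≤ b) (hbc : b ≤ c) (hcx : c ≤ x) (hxq : x ≤ q) :
    posVar y p q n b τ + y c τ - y b τ ≤ posVar y p q (n + 1) x τ := by
  have hK := (isCompact_Icc (a := p) (b := q)).prod (isCompact_Icc (a := p) (b := q))
  have h1 := (continuous_posVar (p := p) (q := q) hy n).comp
    (f := fun P : ℝ × ℝ => (min P.1 (min P.2 x), τ)) (by fun_prop)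
  have h2 := hy.comp (f := fun P : ℝ × ℝ => (min P.1 (min P.2 x), τ)) (by fun_prop)
  have h3 := hy.comp (f := fun P : ℝ × ℝ => (min P.2 x, τ)) (by fun_prop)
  have := le_csSup (hK.image ((h1.add h3).sub h2)).bddAbove
    (Set.mem_image_of_mem _ (⟨⟨hpb, by linarith⟩, ⟨by linarith, by linarith⟩⟩ :
      (b, c) ∈ Set.Icc p q ×ˢ Set.Icc p q))
  simpa only [posVar, Function.comp_def, Pi.add_apply, Pi.sub_apply, min_eq_left hcx,
    min_eq_left hbc] using this

theorem exists_posVar_succ (hy : Continuous fun P : ℝ × ℝ => y P.1 P.2) {x : ℝ} (n : ℕ) (τ : ℝ)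
    (hpx : p ≤ x) (hxq : x ≤ q) :
    ∃ b c, p ≤ b ∧ b ≤ c ∧ c ≤ x ∧
      posVar y p q (n + 1) x τ = posVar y p q n b τ + y c τ - y b τ := by
  have hK := (isCompact_Icc (a := p) (b := q)).prod (isCompact_Icc (a := p) (b := q))
  have h1 := (continuous_posVar (p := p) (q := q) hy n).comp
    (f := fun P : ℝ × ℝ => (min P.1 (min P.2 x), τ)) (by fun_prop)
  have h2 := hy.comp (f := fun P : ℝ × ℝ => (min P.1 (min P.2 x), τ)) (by fun_prop)
  have h3 := hy.comp (f := fun P : ℝ × ℝ => (min P.2 x, τ)) (by fun_prop)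
  have hpq := hpx.trans hxq
  obtain ⟨P, hP, hPe⟩ := hK.exists_sSup_image_eq ⟨(p, p), by simp [hpq]⟩
    ((h1.add h3).sub h2).continuousOn
  refine ⟨min P.1 (min P.2 x), min P.2 x, le_min hP.1.1 (le_min hP.2.1 hpx), min_le_right _ _,
    min_le_right _ _, ?_⟩
  simpa only [posVar, Function.comp_def, Pi.add_apply, Pi.sub_apply] using hPe

theorem posVar_mono (hy : Continuous fun P : ℝ × ℝ => y P.1 P.2) (n : ℕ) {x x' : ℝ} (τ : ℝ)
    (hpx : p ≤ x) (hx : x ≤ x') (hxq : x' ≤ q) :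
    posVar y p q n x τ ≤ posVar y p q n x' τ := by
  cases n with
  | zero =>
    obtain ⟨c, h1, h2, h3⟩ := exists_posVar_zero hy τ hpx (hx.trans hxq)
    rw [h3]
    exact le_posVar_zero hy τ h1 (h2.trans hx) hxq
  | succ n =>
    obtain ⟨b, c, h1, h2, h3, h4⟩ := exists_posVar_succ hy n τ hpx (hx.trans hxq)
    rw [h4]
    exact le_posVar_succ hy τ h1 h2 (h3.trans hx) hxq

theorem posVar_le_succ (hy : Continuous fun P : ℝ × ℝ => y P.1 P.2) (n : ℕ) {x : ℝ} (τ : ℝ)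
    (hpx : p ≤ x) (hxq : x ≤ q) : posVar y p q n x τ ≤ posVar y p q (n + 1) x τ := by
  simpa using le_posVar_succ (n := n) hy τ hpx le_rfl le_rfl hxq

theorem sum_increments_le_posVar (hy : Continuous fun P : ℝ × ℝ => y P.1 P.2) (n : ℕ) (τ : ℝ)
    {x : ℕ → ℝ} (hx : Monotone x) (hx0 : x 0 = p) (hxn : x (n + 1) ≤ q) :
    ∑ i ∈ Finset.range (n + 1), max 0 (y (x (i + 1)) τ - y (x i) τ)
      ≤ posVar y p q n (x (n + 1)) τ := by
  induction n with
  | zero =>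
    have h0 := hx (Nat.zero_le 1)
    simp only [zero_add, Finset.range_one, Finset.sum_singleton]
    refine max_le ?_ ?_
    · simpa [hx0] using le_posVar_zero (c := p) hy τ le_rfl (hx0 ▸ h0) hxn
    · rw [hx0]
      exact le_posVar_zero hy τ (hx0 ▸ h0) le_rfl hxn
  | succ n ih =>
    have hle := hx (Nat.le_succ (n + 1))
    have hp : p ≤ x (n + 1) := hx0 ▸ hx (Nat.zero_le _)
    have h := ih (hle.trans hxn)
    rw [Finset.sum_range_succ]
    rcases max_cases 0 (y (x (n + 1 + 1)) τ - y (x (n + 1)) τ) with ⟨h1, _⟩ | ⟨h1, _⟩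
    · rw [h1]
      have h2 := posVar_mono (q := q) hy n τ hp hle hxn
      have h3 := posVar_le_succ (q := q) hy n τ (hp.trans hle) hxn
      linarith
    · rw [h1]
      have h2 := le_posVar_succ (n := n) hy τ hp hle le_rfl hxn
      linarith

variable {w : ℝ → ℝ} {τ : ℝ}

theorem sub_eq_integral_of_Icc {g w : ℝ → ℝ} {p q a b : ℝ}
    (hg : ∀ x ∈ Set.Icc p q, HasDerivWithinAt g (w x) (Set.Icc p q) x)
    (hw : ContinuousOn w (Set.Icc p q)) (hpa : p ≤ a) (hab : a ≤ b) (hbq : b ≤ q) :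
    ∫ x in a..b, w x = g b - g a := by
  have hsub : Set.Icc a b ⊆ Set.Icc p q := Set.Icc_subset_Icc hpa hbq
  refine intervalIntegral.integral_eq_sub_of_hasDerivAt_of_le hab
    (fun x hx => ((hg x (hsub hx)).mono hsub).continuousWithinAt)
    (fun x hx => (hg x (hsub (Set.Ioo_subset_Icc_self hx))).hasDerivAt
      (Icc_mem_nhds (hpa.trans_lt hx.1) (hx.2.trans_le hbq))) ?_
  exact (hw.mono (by rwa [Set.uIcc_of_le hab])).intervalIntegrable

theorem intervalIntegrable_max_zero {w : ℝ → ℝ} {p q a b : ℝ}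
    (hw : ContinuousOn w (Set.Icc p q)) (hpa : p ≤ a) (hab : a ≤ b) (hbq : b ≤ q) :
    IntervalIntegrable (fun x => max (w x) 0) MeasureTheory.volume a b := by
  refine ContinuousOn.intervalIntegrable ?_
  rw [Set.uIcc_of_le hab]
  exact (hw.mono (Set.Icc_subset_Icc hpa hbq)).sup continuousOn_const

theorem sub_le_integral_max {g w : ℝ → ℝ} {p q a b : ℝ}
    (hg : ∀ x ∈ Set.Icc p q, HasDerivWithinAt g (w x) (Set.Icc p q) x)
    (hw : ContinuousOn w (Set.Icc p q)) (hpa : p ≤ a) (hab : a ≤ b) (hbq : b ≤ q) :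
    g b - g a ≤ ∫ x in a..b, max (w x) 0 := by
  rw [← sub_eq_integral_of_Icc hg hw hpa hab hbq]
  refine intervalIntegral.integral_mono_on hab ?_ (intervalIntegrable_max_zero hw hpa hab hbq)
    fun x _ => le_max_left _ _
  exact (hw.mono (by rw [Set.uIcc_of_le hab]; exact Set.Icc_subset_Icc hpa hbq)).intervalIntegrable

theorem integral_max_nonneg {w : ℝ → ℝ} {a b : ℝ} (hab : a ≤ b) :
    0 ≤ ∫ x in a..b, max (w x) 0 :=
  intervalIntegral.integral_nonneg hab fun _ _ => le_max_right _ _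

theorem posVar_le_integral (hy : Continuous fun P : ℝ × ℝ => y P.1 P.2)
    (hg : ∀ x ∈ Set.Icc p q, HasDerivWithinAt (fun ξ => y ξ τ) (w x) (Set.Icc p q) x)
    (hw : ContinuousOn w (Set.Icc p q)) (n : ℕ) {x : ℝ} (hpx : p ≤ x) (hxq : x ≤ q) :
    posVar y p q n x τ ≤ ∫ ξ in p..x, max (w ξ) 0 := by
  induction n generalizing x with
  | zero =>
    obtain ⟨c, h1, h2, h3⟩ := exists_posVar_zero hy τ hpx hxq
    rw [h3, ← intervalIntegral.integral_add_adjacent_intervals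
      (intervalIntegrable_max_zero hw le_rfl h1 (h2.trans hxq))
      (intervalIntegrable_max_zero hw h1 h2 hxq)]
    have := sub_le_integral_max hg hw le_rfl h1 (h2.trans hxq)
    have := integral_max_nonneg (w := w) h2
    linarith
  | succ n ih =>
    obtain ⟨b, c, h1, h2, h3, h4⟩ := exists_posVar_succ hy n τ hpx hxq
    rw [h4, ← intervalIntegral.integral_add_adjacent_intervals
      (intervalIntegrable_max_zero hw le_rfl (h1.trans h2) (h3.trans hxq))
      (intervalIntegrable_max_zero hw (h1.trans h2) h3 hxq),
      ← intervalIntegral.integral_add_adjacent_intervals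
      (intervalIntegrable_max_zero hw le_rfl h1 (h2.trans (h3.trans hxq)))
      (intervalIntegrable_max_zero hw h1 h2 (h3.trans hxq))]
    have e1 := sub_le_integral_max hg hw h1 h2 (h3.trans hxq)
    have e2 := integral_max_nonneg (w := w) h3
    have e3 := ih h1 (h2.trans (h3.trans hxq))
    linarith

theorem exists_integral_sub_le_posVar (hy : Continuous fun P : ℝ × ℝ => y P.1 P.2)
    (hg : ∀ x ∈ Set.Icc p q, HasDerivWithinAt (fun ξ => y ξ τ) (w x) (Set.Icc p q) x)
    (hw : ContinuousOn w (Set.Icc p q)) (hpq : p < q) {δ : ℝ} (hδ : 0 < δ) :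
    ∃ N, ∀ n ≥ N, (∫ ξ in p..q, max (w ξ) 0) - δ ≤ posVar y p q n q τ := by
  have hL : 0 < q - p := sub_pos.2 hpq
  obtain ⟨ρ, hρ, hρw⟩ := Metric.uniformContinuousOn_iff.1
    (isCompact_Icc.uniformContinuousOn_of_continuous hw) (δ / (q - p)) (div_pos hδ hL)
  obtain ⟨N, hN⟩ := exists_nat_gt ((q - p) / ρ)
  refine ⟨N, fun n hn => ?_⟩
  set h := (q - p) / (n + 1 : ℝ) with hh
  have hn1 : (0 : ℝ) < n + 1 := by positivity
  have hh0 : 0 < h := div_pos hL hn1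
  have hhρ : h < ρ := by
    rw [hh, div_lt_iff₀ hn1]
    rw [div_lt_iff₀ hρ] at hN
    have : (N : ℝ) ≤ n := by exact_mod_cast hn
    nlinarith
  set x : ℕ → ℝ := fun i => p + i * h with hxdef
  have hx : Monotone x := fun i j hij => by
    have : (i : ℝ) ≤ j := by exact_mod_cast hij
    simp only [hxdef]
    nlinarith
  have hx0 : x 0 = p := by simp [hxdef]
  have hxn : x (n + 1) = q := by
    simp only [hxdef, hh]; push_cast; field_simp; ring
  have hmem : ∀ i ≤ n + 1, p ≤ x i ∧ x i ≤ q := fun i hi =>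
    ⟨hx0 ▸ hx (Nat.zero_le i), hxn ▸ hx hi⟩
  have hstep : ∀ i, x (i + 1) - x i = h := fun i => by simp only [hxdef]; push_cast; ring
  have hcell : ∀ i ∈ Finset.range (n + 1), (∫ ξ in x i..x (i + 1), max (w ξ) 0)
      ≤ max 0 (y (x (i + 1)) τ - y (x i) τ) + δ / (q - p) * h := by
    intro i hi
    have hi' : i + 1 ≤ n + 1 := Finset.mem_range.1 hi
    obtain ⟨ha, _⟩ := hmem i (by omega)
    obtain ⟨_, hb⟩ := hmem (i + 1) hi'
    have hab : x i ≤ x (i + 1) := hx (Nat.le_succ i)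
    have hsub : Set.Icc (x i) (x (i + 1)) ⊆ Set.Icc p q := Set.Icc_subset_Icc ha hb
    by_cases hpos : ∀ ξ ∈ Set.Icc (x i) (x (i + 1)), 0 < w ξ
    · have e1 : (∫ ξ in x i..x (i + 1), max (w ξ) 0) = ∫ ξ in x i..x (i + 1), w ξ := by
        refine intervalIntegral.integral_congr fun ξ hξ => ?_
        rw [Set.uIcc_of_le hab] at hξ
        exact max_eq_left (hpos ξ hξ).le
      rw [e1, sub_eq_integral_of_Icc hg hw ha hab hb]
      have : 0 ≤ δ / (q - p) * h := by positivity
      have := le_max_right 0 (y (x (i + 1)) τ - y (x i) τ)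
      linarith
    · push Not at hpos
      obtain ⟨ζ, hζ, hwζ⟩ := hpos
      have e1 : (∫ ξ in x i..x (i + 1), max (w ξ) 0)
          ≤ ∫ _ in x i..x (i + 1), δ / (q - p) := by
        refine intervalIntegral.integral_mono_on hab
          (intervalIntegrable_max_zero hw ha hab hb) (by simp) fun ξ hξ => ?_
        refine max_le ?_ (by positivity)
        have hd : dist ξ ζ < ρ := by
          rw [Real.dist_eq, abs_lt]
          have := hstep i
          constructor <;> linarith [hξ.1, hξ.2, hζ.1, hζ.2]
        have := hρw ξ (hsub hξ) ζ (hsub hζ) hd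
        rw [Real.dist_eq] at this
        linarith [(abs_lt.1 this).2]
      rw [intervalIntegral.integral_const, hstep, smul_eq_mul] at e1
      have := le_max_left 0 (y (x (i + 1)) τ - y (x i) τ)
      linarith
  have hsum := Finset.sum_le_sum hcell
  rw [intervalIntegral.sum_integral_adjacent_intervals (fun k hk =>
    intervalIntegrable_max_zero hw (hmem k hk.le).1 (hx (Nat.le_succ k)) (hmem (k + 1) hk).2),
    hx0, hxn, Finset.sum_add_distrib, Finset.sum_const, Finset.card_range, nsmul_eq_mul] at hsum
  have e2 : ((n + 1 : ℕ) : ℝ) * (δ / (q - p) * h) = δ := by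
    rw [hh]; push_cast; field_simp
  have e3 := sum_increments_le_posVar hy n τ hx hx0 hxn.le
  rw [hxn] at e3
  linarith

end PosVar

section PosVarEvolution

theorem HasDerivWithinAt.nonpos_of_forall_le_right {g : ℝ → ℝ} {g' a b : ℝ} {s : Set ℝ}
    (hg : HasDerivWithinAt g g' s a) (hab : a < b) (hs : Set.Icc a b ⊆ s)
    (hmax : ∀ x, a < x → x ≤ b → g x ≤ g a) : g' ≤ 0 := by
  have h := (hasDerivWithinAt_iff_tendsto_slope' (by simp)).1
    (hg.mono (Set.Ioc_subset_Icc_self.trans hs))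
  have : (nhdsWithin a (Set.Ioc a b)).NeBot := by
    rw [nhdsWithin_Ioc_eq_nhdsGT hab]; infer_instance
  refine le_of_tendsto h (eventually_mem_nhdsWithin.mono fun x hx => ?_)
  rw [slope_def_field]
  exact div_nonpos_of_nonpos_of_nonneg (by linarith [hmax x hx.1 hx.2]) (by linarith [hx.1])

theorem HasDerivWithinAt.nonneg_of_forall_le_left {g : ℝ → ℝ} {g' a b : ℝ} {s : Set ℝ}
    (hg : HasDerivWithinAt g g' s b) (hab : a < b) (hs : Set.Icc a b ⊆ s)
    (hmax : ∀ x, a ≤ x → x < b → g x ≤ g b) : 0 ≤ g' := by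
  have h := (hasDerivWithinAt_iff_tendsto_slope' (by simp)).1
    (hg.mono (Set.Ico_subset_Icc_self.trans hs))
  have : (nhdsWithin b (Set.Ico a b)).NeBot := by
    rw [nhdsWithin_Ico_eq_nhdsLT hab]; infer_instance
  refine ge_of_tendsto h (eventually_mem_nhdsWithin.mono fun x hx => ?_)
  rw [slope_def_field]
  exact div_nonneg_of_nonpos (by linarith [hmax x hx.1 hx.2]) (by linarith [hx.2])

variable {y : ℝ → ℝ → ℝ} {p q τ : ℝ} {w Θ B : ℝ → ℝ} {I : Set ℝ}

theorem exists_touching_posVar (hy : Continuous fun P : ℝ × ℝ => y P.1 P.2)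
    (hg : ∀ x ∈ Set.Icc p q, HasDerivWithinAt (fun ξ => y ξ τ) (w x) (Set.Icc p q) x)
    (hΘ : ∀ x ∈ Set.Icc p q, HasDerivWithinAt (fun σ => y x σ) (Θ x) I τ)
    (hB : MonotoneOn B (Set.Icc p q)) (hzero : ∀ x ∈ Set.Icc p q, w x = 0 → Θ x = B x)
    (hwp : 0 < w p) (n : ℕ) {x : ℝ} (hpx : p ≤ x) (hxq : x ≤ q) :
    ∃ (G : ℝ → ℝ) (d : ℝ), (∀ σ, G σ ≤ posVar y p q n x σ) ∧ G τ = posVar y p q n x τ ∧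
      HasDerivWithinAt G d I τ ∧
      ((-(Θ p - B p) ≤ d ∧ ∃ e, p ≤ e ∧ e < x ∧ posVar y p q n e τ = posVar y p q n x τ) ∨
        (0 ≤ w x ∧ (Θ x - B x) - (Θ p - B p) ≤ d)) := by
  have hright : ∀ a b, p ≤ a → a < b → b ≤ q → (∀ ξ, a < ξ → ξ ≤ b → y ξ τ ≤ y a τ) → w a ≤ 0 :=
    fun a b hpa hab hbq h => (hg a ⟨hpa, hab.le.trans hbq⟩).nonpos_of_forall_le_right hab
      (Set.Icc_subset_Icc hpa hbq) h
  have hleft : ∀ a b, p ≤ a → a < b → b ≤ q → (∀ ξ, a ≤ ξ → ξ < b → y ξ τ ≤ y b τ) → 0 ≤ w b :=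
    fun a b hpa hab hbq h => (hg b ⟨hpa.trans hab.le, hbq⟩).nonneg_of_forall_le_left hab
      (Set.Icc_subset_Icc hpa hbq) h
  have hpmem : p ∈ Set.Icc p q := ⟨le_rfl, hpx.trans hxq⟩
  induction n generalizing x with
  | zero =>
    obtain ⟨c, hpc, hcx, hc⟩ := exists_posVar_zero hy τ hpx hxq
    have hcm : c ∈ Set.Icc p q := ⟨hpc, hcx.trans hxq⟩
    have hmax : ∀ ξ, p ≤ ξ → ξ ≤ x → y ξ τ ≤ y c τ := fun ξ h1 h2 => by
      have := le_posVar_zero hy τ h1 h2 hxq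
      linarith
    have hBc := hB hpmem hcm hpc
    refine ⟨fun σ => y c σ - y p σ, Θ c - Θ p, fun σ => le_posVar_zero hy σ hpc hcx hxq, hc.symm,
      (hΘ c hcm).sub (hΘ p hpmem), ?_⟩
    rcases hcx.eq_or_lt with rfl | hcx'
    · right
      refine ⟨?_, by linarith⟩
      rcases hpc.eq_or_lt with rfl | hpc'
      · exact hwp.le
      · exact hleft p c le_rfl hpc' hxq fun ξ h1 h2 => hmax ξ h1 h2.le
    · left
      have hpc' : p < c := by
        refine lt_of_le_of_ne hpc ?_
        rintro rfl
        exact absurd (hright p x le_rfl hcx' hxq fun ξ h1 h2 => hmax ξ h1.le h2) (not_le.2 hwp)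
      have h1 := hleft p c le_rfl hpc' hcm.2 fun ξ h1 h2 => hmax ξ h1 (h2.le.trans hcx)
      have h2 := hright c x hpc hcx' hxq fun ξ h1 h2 => hmax ξ (hpc.trans h1.le) h2
      have h3 := hzero c hcm (le_antisymm h2 h1)
      refine ⟨by linarith, c, hpc, hcx', le_antisymm (posVar_mono hy 0 τ hpc hcx hxq) ?_⟩
      rw [hc]
      exact le_posVar_zero hy τ hpc le_rfl hcm.2
  | succ n ih =>
    obtain ⟨b, c, hpb, hbc, hcx, hc⟩ := exists_posVar_succ hy n τ hpx hxq
    rcases hbc.eq_or_lt with rfl | hbc'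
    · obtain ⟨G, d, hG1, hG2, hG3, hG4⟩ := ih hpx hxq
      have h1 := posVar_mono hy n τ hpb hcx hxq
      have h2 := posVar_le_succ hy n τ hpx hxq
      have h3 : posVar y p q n x τ = posVar y p q (n + 1) x τ := by linarith
      refine ⟨G, d, fun σ => (hG1 σ).trans (posVar_le_succ hy n σ hpx hxq), by rw [hG2, h3],
        hG3, hG4.imp ?_ id⟩
      rintro ⟨hd, e, hpe, hex, he⟩
      refine ⟨hd, e, hpe, hex, le_antisymm (posVar_mono hy _ τ hpe hex.le hxq) ?_⟩
      rw [← h3, ← he]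
      exact posVar_le_succ hy n τ hpe (hex.le.trans hxq)
    have hpc : p ≤ c := hpb.trans hbc
    have hcq := hcx.trans hxq
    have hcm : c ∈ Set.Icc p q := ⟨hpc, hcq⟩
    have hbm : b ∈ Set.Icc p q := ⟨hpb, hbc.trans hcq⟩
    have hmaxc : ∀ ξ, b ≤ ξ → ξ ≤ x → y ξ τ ≤ y c τ := fun ξ h1 h2 => by
      have := le_posVar_succ (n := n) hy τ hpb h1 h2 hxq
      linarith
    have hmaxb : ∀ ξ, p ≤ ξ → ξ ≤ c →
        posVar y p q n ξ τ - y ξ τ ≤ posVar y p q n b τ - y b τ := fun ξ h1 h2 => by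
      have := le_posVar_succ (n := n) hy τ h1 h2 hcx hxq
      linarith
    have hBbc := hB hbm hcm hbc
    obtain ⟨G, d, hG1, hG2, hG3, hG4⟩ := ih hpb hbm.2
    have hd : (Θ c - B c) - (Θ p - B p) ≤ d + Θ c - Θ b := by
      rcases hG4 with ⟨hd, e, hpe, heb, he⟩ | ⟨_, hd⟩
      · have h1 : w b ≤ 0 := by
          have := (hg b hbm).neg.nonneg_of_forall_le_left heb
            (Set.Icc_subset_Icc hpe hbm.2) fun ξ h1 h2 => by
              have e1 := posVar_mono hy n τ hpe h1 (h2.le.trans hbm.2)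
              have e2 := hmaxb ξ (hpe.trans h1) (h2.le.trans hbc)
              simp only [Pi.neg_apply]
              linarith
          linarith
        have h2 : 0 ≤ w b := by
          have := (hg b hbm).neg.nonpos_of_forall_le_right hbc'
            (Set.Icc_subset_Icc hpb hcq) fun ξ h1 h2 => by
              have e1 := posVar_mono hy n τ hpb h1.le (h2.trans hcq)
              have e2 := hmaxb ξ (hpb.trans h1.le) h2
              simp only [Pi.neg_apply]
              linarith
          linarith
        have h3 := hzero b hbm (le_antisymm h1 h2)
        linarith
      · linarith
    have hwc : 0 ≤ w c := hleft b c hpb hbc' hcq fun ξ h1 h2 => hmaxc ξ h1 (h2.le.trans hcx)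
    refine ⟨fun σ => G σ + y c σ - y b σ, d + Θ c - Θ b, fun σ => ?_, ?_,
      (hG3.add (hΘ c hcm)).sub (hΘ b hbm), ?_⟩
    · have e1 := hG1 σ
      have e2 := le_posVar_succ (n := n) hy σ hpb hbc hcx hxq
      linarith
    · rw [hc, ← hG2]
    · rcases hcx.eq_or_lt with rfl | hcx'
      · exact Or.inr ⟨hwc, hd⟩
      · have h2 := hright c x hpc hcx' hxq fun ξ h1 h2 => hmaxc ξ (hbc.trans h1.le) h2
        have h3 := hzero c hcm (le_antisymm h2 hwc)
        refine Or.inl ⟨by linarith, c, hpc, hcx', le_antisymm (posVar_mono hy _ τ hpc hcx hxq) ?_⟩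
        rw [hc]
        exact le_posVar_succ hy τ hpb hbc le_rfl hcq

theorem integral_max_evolution_lower_bound {y w Θ B : ℝ → ℝ → ℝ} {p q s t lp lq : ℝ}
    (hy : Continuous fun P : ℝ × ℝ => y P.1 P.2) (hpq : p < q) (hst : s ≤ t)
    (hg : ∀ τ ∈ Set.Icc s t, ∀ x ∈ Set.Icc p q,
      HasDerivWithinAt (fun ξ => y ξ τ) (w x τ) (Set.Icc p q) x)
    (hw : ∀ τ ∈ Set.Icc s t, ContinuousOn (fun x => w x τ) (Set.Icc p q))
    (hΘ : ∀ τ ∈ Set.Icc s t, ∀ x ∈ Set.Icc p q,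
      HasDerivWithinAt (fun σ => y x σ) (Θ x τ) (Set.Icc s t) τ)
    (hB : ∀ τ ∈ Set.Icc s t, MonotoneOn (fun x => B x τ) (Set.Icc p q))
    (hzero : ∀ τ ∈ Set.Icc s t, ∀ x ∈ Set.Icc p q, w x τ = 0 → Θ x τ = B x τ)
    (hwp : ∀ τ ∈ Set.Icc s t, 0 < w p τ)
    (hlp : ∀ τ ∈ Set.Icc s t, Θ p τ - B p τ ≤ lp)
    (hlq : ∀ τ ∈ Set.Icc s t, 0 ≤ w q τ → -lq ≤ Θ q τ - B q τ) (hlq0 : 0 ≤ lq) :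
    -(lp + lq) * (t - s) ≤ (∫ x in p..q, max (w x t) 0) - ∫ x in p..q, max (w x s) 0 := by
  have key : ∀ n, -(lp + lq) * (t - s) ≤ posVar y p q n q t - posVar y p q n q s := by
    intro n
    have hc : Continuous fun τ => -posVar y p q n q τ :=
      ((continuous_posVar hy n).comp (f := fun τ : ℝ => (q, τ)) (by fun_prop)).neg
    have := image_le_of_liminf_slope_right_le_deriv_boundary (f := fun τ => -posVar y p q n q τ)
      (a := s) (b := t) (B := fun τ => -posVar y p q n q s + (lp + lq) * (τ - s))
      (B' := fun _ => lp + lq) hc.continuousOn (by simp) (by fun_prop)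
      (fun τ _ => by
        simpa using ((((hasDerivAt_id τ).sub_const s).const_mul (lp + lq)).const_add
          (-posVar y p q n q s)).hasDerivWithinAt)
      (fun τ hτ r hr => ?_) (Set.right_mem_Icc.2 hst)
    · linarith
    · have hτ' := Set.Ico_subset_Icc_self hτ
      obtain ⟨G, d, hG1, hG2, hG3, hG4⟩ := exists_touching_posVar hy (hg τ hτ') (hΘ τ hτ')
        (hB τ hτ') (hzero τ hτ') (hwp τ hτ') n hpq.le le_rfl
      have hd : -d < r := by
        rcases hG4 with ⟨h1, _⟩ | ⟨h1, h2⟩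
        · linarith [hlp τ hτ']
        · linarith [hlp τ hτ', hlq τ hτ' h1]
      have hG := (hG3.neg.mono_of_mem_nhdsWithin (Icc_mem_nhdsGE_of_mem hτ)).liminf_right_slope_le hd
      refine (hG.and_eventually self_mem_nhdsWithin).mono fun σ hσ => lt_of_le_of_lt ?_ hσ.1
      have hσ' : τ < σ := hσ.2
      rw [slope_def_field, slope_def_field]
      refine div_le_div_of_nonneg_right ?_ (by linarith)
      have := hG1 σ
      simp only [Pi.neg_apply]
      linarith
  refine le_of_forall_pos_sub_le fun δ hδ => ?_
  obtain ⟨N, hN⟩ := exists_integral_sub_le_posVar hy (hg s ⟨le_rfl, hst⟩) (hw s ⟨le_rfl, hst⟩)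
    hpq hδ
  have h1 := hN N le_rfl
  have h2 := posVar_le_integral hy (hg t ⟨hst, le_rfl⟩) (hw t ⟨hst, le_rfl⟩) N hpq.le le_rfl
  have h3 := key N
  linarith

theorem integral_max_evolution_lower_bound_of_continuousOn {y w Θ B : ℝ → ℝ → ℝ}
    {p q s t lp lq : ℝ} (hpq : p < q) (hst : s ≤ t)
    (hy : ContinuousOn (fun P : ℝ × ℝ => y P.1 P.2) (Set.Icc p q ×ˢ Set.Icc s t))
    (hg : ∀ τ ∈ Set.Icc s t, ∀ x ∈ Set.Icc p q, HasDerivAt (fun ξ => y ξ τ) (w x τ) x)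
    (hw : ∀ τ ∈ Set.Icc s t, ContinuousOn (fun x => w x τ) (Set.Icc p q))
    (hΘ : ∀ τ ∈ Set.Icc s t, ∀ x ∈ Set.Icc p q, HasDerivAt (fun σ => y x σ) (Θ x τ) τ)
    (hB : ∀ τ ∈ Set.Icc s t, MonotoneOn (fun x => B x τ) (Set.Icc p q))
    (hzero : ∀ τ ∈ Set.Icc s t, ∀ x ∈ Set.Icc p q, w x τ = 0 → Θ x τ = B x τ)
    (hwp : ∀ τ ∈ Set.Icc s t, 0 < w p τ)
    (hlp : ∀ τ ∈ Set.Icc s t, Θ p τ - B p τ ≤ lp)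
    (hlq : ∀ τ ∈ Set.Icc s t, 0 ≤ w q τ → -lq ≤ Θ q τ - B q τ) (hlq0 : 0 ≤ lq) :
    -(lp + lq) * (t - s) ≤ (∫ x in p..q, max (w x t) 0) - ∫ x in p..q, max (w x s) 0 := by
  set Y : ℝ → ℝ → ℝ := fun x τ => y (Set.projIcc p q hpq.le x) (Set.projIcc s t hst τ) with hY
  have hYeq : ∀ x ∈ Set.Icc p q, ∀ τ ∈ Set.Icc s t, Y x τ = y x τ := fun x hx τ hτ => by
    simp only [hY, Set.projIcc_of_mem hpq.le hx, Set.projIcc_of_mem hst hτ]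
  have hYc : Continuous fun P : ℝ × ℝ => Y P.1 P.2 :=
    hy.comp_continuous (f := fun P : ℝ × ℝ =>
      ((Set.projIcc p q hpq.le P.1 : ℝ), (Set.projIcc s t hst P.2 : ℝ)))
      (((continuous_subtype_val.comp continuous_projIcc).comp continuous_fst).prodMk
        ((continuous_subtype_val.comp continuous_projIcc).comp continuous_snd))
      fun P => ⟨(Set.projIcc p q hpq.le P.1).2, (Set.projIcc s t hst P.2).2⟩
  exact integral_max_evolution_lower_bound hYc hpq hst
    (fun τ hτ x hx => (hg τ hτ x hx).hasDerivWithinAt.congr (fun ξ hξ => hYeq ξ hξ τ hτ)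
      (hYeq x hx τ hτ)) hw
    (fun τ hτ x hx => (hΘ τ hτ x hx).hasDerivWithinAt.congr (fun σ hσ => hYeq x hx σ hσ)
      (hYeq x hx τ hτ)) hB hzero hwp hlp hlq hlq0

end PosVarEvolution

section Collar

open Filter Topology

theorem IsLocalMin.nonneg_of_hasDerivAt_deriv {f f' : ℝ → ℝ} {f'' a : ℝ} (hmin : IsLocalMin f a)
    (hf : ∀ᶠ x in 𝓝 a, HasDerivAt f (f' x) x) (hf' : HasDerivAt f' f'' a) : 0 ≤ f'' := by
  by_contra! hneg
  have hd : deriv (-f) =ᶠ[𝓝 a] -f' := hf.mono fun x hx => hx.neg.deriv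
  have hdd : deriv (deriv (-f)) a = -f'' := by rw [hd.deriv_eq]; exact hf'.neg.deriv
  have h0 : f' a = 0 := hmin.hasDerivAt_eq_zero hf.self_of_nhds
  have hmax : IsLocalMin (-f) a := isLocalMin_of_deriv_deriv_pos (by rw [hdd]; linarith)
    (by rw [hd.self_of_nhds]; simp [h0]) hf.self_of_nhds.continuousAt.neg
  have hconst : f =ᶠ[𝓝 a] fun _ => f a := by
    filter_upwards [hmin, hmax] with x h1 h2
    simp only [Pi.neg_apply] at h2
    linarith
  have hf0 : f' =ᶠ[𝓝 a] fun _ => 0 := by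
    filter_upwards [hf, hconst.eventuallyEq_nhds] with x h1 h2
    exact h1.unique ((hasDerivAt_const x (f a)).congr_of_eventuallyEq h2)
  have := hf'.unique ((hasDerivAt_const a (0 : ℝ)).congr_of_eventuallyEq hf0)
  linarith

theorem IsLocalMax.nonpos_of_hasDerivAt_deriv {f f' : ℝ → ℝ} {f'' a : ℝ} (hmax : IsLocalMax f a)
    (hf : ∀ᶠ x in 𝓝 a, HasDerivAt f (f' x) x) (hf' : HasDerivAt f' f'' a) : f'' ≤ 0 := by
  have := hmax.neg.nonneg_of_hasDerivAt_deriv (f' := fun x => -f' x)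
    (hf.mono fun x hx => hx.neg) hf'.neg
  linarith

theorem le_of_collar_contact {m e s₀ s₁ : ℝ} {y w Θ B β : ℝ → ℝ → ℝ} {z z' : ℝ → ℝ}
    (hme : m < e) (hs : s₀ ≤ s₁)
    (hyC : ContinuousOn (fun P : ℝ × ℝ => y P.1 P.2) (Set.Icc m e ×ˢ Set.Icc s₀ s₁))
    (hwC : ContinuousOn (fun P : ℝ × ℝ => w P.1 P.2) (Set.Icc m e ×ˢ Set.Icc s₀ s₁))
    (hΘC : ContinuousOn (fun P : ℝ × ℝ => Θ P.1 P.2) (Set.Icc m e ×ˢ Set.Icc s₀ s₁))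
    (hBC : ContinuousOn (fun P : ℝ × ℝ => B P.1 P.2) (Set.Icc m e ×ˢ Set.Icc s₀ s₁))
    (hy : ∀ τ ∈ Set.Icc s₀ s₁, ∀ x ∈ Set.Icc m e, HasDerivAt (fun ξ => y ξ τ) (w x τ) x)
    (hΘ : ∀ τ ∈ Set.Ioc s₀ s₁, ∀ x ∈ Set.Icc m e, HasDerivAt (fun σ => y x σ) (Θ x τ) τ)
    (hB : ∀ τ ∈ Set.Icc s₀ s₁, MonotoneOn (fun x => B x τ) (Set.Icc m e))
    (hzero : ∀ τ ∈ Set.Icc s₀ s₁, ∀ x ∈ Set.Icc m e, w x τ = 0 → Θ x τ = B x τ)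
    (hcontact : ∀ τ ∈ Set.Ioc s₀ s₁, ∀ x ∈ Set.Ioo m e, w x τ = z x →
      ∃ w', HasDerivAt (fun ξ => w ξ τ) w' x ∧ (z' x ≤ w' → β x τ ≤ Θ x τ - B x τ) ∧
        (w' ≤ z' x → Θ x τ - B x τ ≤ β x τ))
    (hβ : ∀ τ ∈ Set.Icc s₀ s₁, MonotoneOn (fun x => β x τ) (Set.Icc m e))
    (hβe : ∀ τ ∈ Set.Icc s₀ s₁, β e τ = 0)
    (hzC : ContinuousOn z (Set.Icc m e)) (hz : ∀ x ∈ Set.Ioo m e, HasDerivAt z (z' x) x)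
    (hzpos : ∀ x ∈ Set.Ico m e, 0 < z x) (hze : z e = 0)
    (hwm : ∀ τ ∈ Set.Icc s₀ s₁, z m < w m τ) (hinit : ∀ x ∈ Set.Icc m e, z x ≤ w x s₀) :
    ∀ τ ∈ Set.Icc s₀ s₁, ∀ x ∈ Set.Icc m e, z x ≤ w x τ := by
  set pr : ℝ → ℝ := fun x => Set.projIcc m e hme.le x with hpr
  set pt : ℝ → ℝ := fun x => Set.projIcc s₀ s₁ hs x with hpt
  have hprC : Continuous pr := continuous_subtype_val.comp continuous_projIcc
  have hptC : Continuous pt := continuous_subtype_val.comp continuous_projIcc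
  set h : ℝ → ℝ → ℝ := fun τ x => z (pr x) - max (w (pr x) (pt τ)) 0 with hh
  have heq : ∀ τ ∈ Set.Icc s₀ s₁, ∀ x ∈ Set.Icc m e, h τ x = z x - max (w x τ) 0 :=
    fun τ hτ x hx => by
      simp only [hh, hpr, hpt, Set.projIcc_of_mem hme.le hx, Set.projIcc_of_mem hs hτ]
  have hhC : Continuous fun P : ℝ × ℝ => h P.1 P.2 := by
    have h1 : Continuous fun P : ℝ × ℝ => z (pr P.2) :=
      hzC.comp_continuous (hprC.comp continuous_snd) fun P => (Set.projIcc m e hme.le P.2).2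
    have h2 : Continuous fun P : ℝ × ℝ => w (pr P.2) (pt P.1) :=
      hwC.comp_continuous (f := fun P : ℝ × ℝ => (pr P.2, pt P.1))
        ((hprC.comp continuous_snd).prodMk (hptC.comp continuous_fst))
        fun P => ⟨(Set.projIcc m e hme.le P.2).2, (Set.projIcc s₀ s₁ hs P.1).2⟩
    exact h1.sub (h2.max continuous_const)
  have hhτ : ∀ τ, Continuous (h τ) := fun τ =>
    hhC.comp (f := fun x : ℝ => (τ, x)) (by fun_prop)
  set H : ℝ → ℝ → ℝ := fun x τ => ∫ ξ in m..x, h τ ξ with hH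
  have hHC : Continuous fun P : ℝ × ℝ => H P.1 P.2 :=
    intervalIntegral.continuous_parametric_intervalIntegral_of_continuous
      (f := fun (P : ℝ × ℝ) (ξ : ℝ) => h P.2 ξ)
      (hhC.comp (f := fun Q : (ℝ × ℝ) × ℝ => (Q.1.2, Q.2)) (by fun_prop)) continuous_fst
  have hHd : ∀ τ x, HasDerivAt (fun x => H x τ) (h τ x) x := fun τ x =>
    intervalIntegral.integral_hasDerivAt_right ((hhτ τ).intervalIntegrable _ _)
      ((hhτ τ).stronglyMeasurableAtFilter _ _) (hhτ τ).continuousAt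
  have hHsub : ∀ τ a b, H b τ - H a τ = ∫ ξ in a..b, h τ ξ := fun τ a b =>
    intervalIntegral.integral_interval_sub_left ((hhτ τ).intervalIntegrable _ _)
      ((hhτ τ).intervalIntegrable _ _)
  by_contra hcon
  push Not at hcon
  -- a positive integral of the defect
  obtain ⟨t₀, ht₀, p₀, q₀, hp₀, hpq₀, hq₀, hD₀⟩ : ∃ t₀ ∈ Set.Icc s₀ s₁, ∃ p₀ q₀, m ≤ p₀ ∧
      p₀ ≤ q₀ ∧ q₀ ≤ e ∧ 0 < H q₀ t₀ - H p₀ t₀ := by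
    obtain ⟨t₀, ht₀, x₁, hx₁, hlt₁⟩ := hcon
    obtain ⟨x₀, hx₀, hlt⟩ : ∃ x₀ ∈ Set.Ico m e, w x₀ t₀ < z x₀ := by
      rcases hx₁.2.eq_or_lt with rfl | hlt
      · have hc1 : ContinuousWithinAt (fun x => w x t₀) (Set.Icc m x₁) x₁ :=
          (hwC (x₁, t₀) ⟨hx₁, ht₀⟩).comp (f := fun x : ℝ => (x, t₀))
            (by fun_prop) fun x hx => ⟨hx, ht₀⟩
        have hev := (hc1.eventually_lt (hzC x₁ hx₁) hlt₁).filter_mono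
          (nhdsWithin_mono x₁ (show Set.Ico m x₁ ⊆ Set.Icc m x₁ from Set.Ico_subset_Icc_self))
        have : (𝓝[Set.Ico m x₁] x₁).NeBot := by
          rw [nhdsWithin_Ico_eq_nhdsLT hme]; infer_instance
        obtain ⟨x, hx, hxm⟩ := (hev.and self_mem_nhdsWithin).exists
        exact ⟨x, hxm, hx⟩
      · exact ⟨x₁, ⟨hx₁.1, hlt⟩, hlt₁⟩
    have hx₀' : m < x₀ := lt_of_le_of_ne hx₀.1 (by
      rintro rfl; exact absurd (hwm t₀ ht₀) (not_lt.2 hlt.le))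
    have hpos : 0 < h t₀ x₀ := by
      rw [heq t₀ ht₀ x₀ (Set.Ico_subset_Icc_self hx₀)]
      exact sub_pos.2 (max_lt hlt (hzpos x₀ hx₀))
    have hev : ∀ᶠ x in 𝓝[≥] x₀, 0 < h t₀ x ∧ x < e :=
      (((hhτ t₀).tendsto x₀).eventually (lt_mem_nhds hpos) |>.and
        (Iio_mem_nhds hx₀.2)).filter_mono nhdsWithin_le_nhds
    obtain ⟨b, hb, hsub⟩ := mem_nhdsGE_iff_exists_Icc_subset.1 hev
    refine ⟨t₀, ht₀, x₀, b, hx₀.1, le_of_lt hb, (hsub ⟨le_of_lt hb, le_rfl⟩).2.le, ?_⟩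
    rw [hHsub]
    exact intervalIntegral.intervalIntegral_pos_of_pos_on ((hhτ t₀).intervalIntegrable _ _)
      (fun x hx => (hsub (Set.Ioo_subset_Icc_self hx)).1) hb
  set ε := (H q₀ t₀ - H p₀ t₀) / (2 * (t₀ - s₀ + 1)) with hε
  have ht₀1 : 0 < t₀ - s₀ + 1 := by linarith [ht₀.1]
  have hεpos : 0 < ε := by positivity
  have hJ₀ : 0 < H q₀ t₀ - H p₀ t₀ - ε * (t₀ - s₀) := by
    have : ε * (t₀ - s₀ + 1) = (H q₀ t₀ - H p₀ t₀) / 2 := by rw [hε]; field_simp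
    nlinarith
  set K : Set (ℝ × ℝ × ℝ) := (Set.Icc m e ×ˢ (Set.Icc m e ×ˢ Set.Icc s₀ s₁)) ∩
    {P | P.1 ≤ P.2.1} with hK
  have hKc : IsCompact K := (isCompact_Icc.prod (isCompact_Icc.prod isCompact_Icc)).inter_right
    (isClosed_le continuous_fst (continuous_fst.comp continuous_snd))
  have hJc : Continuous fun P : ℝ × ℝ × ℝ => H P.2.1 P.2.2 - H P.1 P.2.2 - ε * (P.2.2 - s₀) := by
    have h1 := hHC.comp (f := fun P : ℝ × ℝ × ℝ => (P.2.1, P.2.2)) (by fun_prop)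
    have h2 := hHC.comp (f := fun P : ℝ × ℝ × ℝ => (P.1, P.2.2)) (by fun_prop)
    exact (h1.sub h2).sub (by fun_prop)
  have hP₀ : (p₀, q₀, t₀) ∈ K := ⟨⟨⟨hp₀, hpq₀.trans hq₀⟩, ⟨hp₀.trans hpq₀, hq₀⟩, ht₀⟩, hpq₀⟩
  obtain ⟨⟨p, q, t⟩, ⟨⟨hp, hq, ht⟩, hpq⟩, hmax⟩ := hKc.exists_isMaxOn ⟨_, hP₀⟩ hJc.continuousOn
  have hJmax : ∀ p' q' t', p' ∈ Set.Icc m e → q' ∈ Set.Icc m e → t' ∈ Set.Icc s₀ s₁ → p' ≤ q' →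
      H q' t' - H p' t' - ε * (t' - s₀) ≤ H q t - H p t - ε * (t - s₀) :=
    fun p' q' t' h1 h2 h3 h4 => hmax (a := (p', q', t')) ⟨⟨h1, h2, h3⟩, h4⟩
  have hJpos : 0 < H q t - H p t - ε * (t - s₀) :=
    hJ₀.trans_le (hJmax p₀ q₀ t₀ hP₀.1.1 hP₀.1.2.1 ht₀ hpq₀)
  simp only [Set.mem_ofPred_eq] at hpq hp hq ht
  have hts₀ : s₀ < t := by
    refine lt_of_le_of_ne ht.1 ?_
    rintro rfl
    have : H q s₀ - H p s₀ ≤ 0 := by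
      rw [hHsub, ← neg_nonneg, ← intervalIntegral.integral_neg]
      refine intervalIntegral.integral_nonneg hpq fun x hx => ?_
      have hx' : x ∈ Set.Icc m e := ⟨hp.1.trans hx.1, hx.2.trans hq.2⟩
      rw [heq s₀ ht x hx']
      linarith [hinit x hx', le_max_left (w x s₀) 0]
    linarith
  have hpq' : p < q := by
    refine lt_of_le_of_ne hpq ?_
    rintro rfl
    nlinarith
  have hminp : ∀ p' ∈ Set.Icc m q, H p t ≤ H p' t := fun p' hp' => by
    linarith [hJmax p' q t ⟨hp'.1, hp'.2.trans hq.2⟩ hq ht hp'.2]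
  have hmaxq : ∀ q' ∈ Set.Icc p e, H q' t ≤ H q t := fun q' hq' => by
    linarith [hJmax p q' t hp ⟨hp.1.trans hq'.1, hq'.2⟩ ht hq'.1]
  have hmp : m < p := by
    refine lt_of_le_of_ne hp.1 ?_
    rintro rfl
    have h1 := (hHd t m).neg.hasDerivWithinAt (s := Set.univ) |>.nonpos_of_forall_le_right hpq'
      (Set.subset_univ _) fun x h1 h2 => by
        simpa using hminp x ⟨h1.le, h2⟩
    rw [heq t ht m hp] at h1
    linarith [hwm t ht, le_max_left (w m t) 0]
  have hcritical : ∀ x ∈ Set.Ioo m e, h t x = 0 → w x t = z x ∧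
      ∃ w', HasDerivAt (h t) (z' x - w') x ∧ (z' x ≤ w' → β x t ≤ Θ x t - B x t) ∧
        (w' ≤ z' x → Θ x t - B x t ≤ β x t) := by
    intro x hx hx0
    rw [heq t ht x (Set.Ioo_subset_Icc_self hx)] at hx0
    have hzx := hzpos x (Set.Ioo_subset_Ico_self hx)
    have hwx : w x t = z x := by
      rcases max_cases (w x t) 0 with ⟨h1, _⟩ | ⟨h1, _⟩ <;> linarith
    obtain ⟨w', hw', hA, hA'⟩ := hcontact t ⟨hts₀, ht.2⟩ x hx hwx
    refine ⟨hwx, w', ?_, hA, hA'⟩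
    refine ((hz x hx).sub hw').congr_of_eventuallyEq ?_
    filter_upwards [Icc_mem_nhds hx.1 hx.2,
      hw'.continuousAt.eventually (lt_mem_nhds (show 0 < w x t by linarith))] with ξ h1 h2
    rw [heq t ht ξ h1, max_eq_left h2.le]
    rfl
  -- velocity at the left endpoint
  have hpmem : p ∈ Set.Ioo m e := ⟨hmp, hpq'.trans_le hq.2⟩
  have hlmin : IsLocalMin (fun x => H x t) p :=
    Filter.mem_of_superset (Icc_mem_nhds hmp hpq') hminp
  obtain ⟨hwp, wp', hwp1, -, hwp2⟩ := hcritical p hpmem (hlmin.hasDerivAt_eq_zero (hHd t p))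
  have hΓp : Θ p t - B p t ≤ β p t := hwp2 (by
    have := hlmin.nonneg_of_hasDerivAt_deriv (Eventually.of_forall (hHd t)) hwp1
    linarith)
  -- velocity at the right endpoint
  have hΓq : 0 ≤ w q t → β q t ≤ Θ q t - B q t := by
    intro hwq
    rcases hq.2.eq_or_lt with rfl | hqe
    · have h1 := (hHd t q).hasDerivWithinAt (s := Set.univ) |>.nonneg_of_forall_le_left hpq'
        (Set.subset_univ _) fun x h1 h2 => hmaxq x ⟨h1, h2.le⟩
      rw [heq t ht q hq, hze] at h1
      have h2 := hzero t ht q hq (by linarith [le_max_left (w q t) 0])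
      rw [hβe t ht, h2, sub_self]
    · have hlmax : IsLocalMax (fun x => H x t) q :=
        Filter.mem_of_superset (Icc_mem_nhds hpq' hqe) hmaxq
      obtain ⟨_, wq', hwq1, hwq2, -⟩ := hcritical q ⟨hmp.trans hpq', hqe⟩
        (hlmax.hasDerivAt_eq_zero (hHd t q))
      refine hwq2 ?_
      have := hlmax.nonpos_of_hasDerivAt_deriv (Eventually.of_forall (hHd t)) hwq1
      linarith
  have hslice : ∀ (g : ℝ → ℝ → ℝ), ContinuousOn (fun P : ℝ × ℝ => g P.1 P.2)
      (Set.Icc m e ×ˢ Set.Icc s₀ s₁) → ∀ x ∈ Set.Icc m e,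
      ContinuousWithinAt (fun τ => g x τ) (Set.Iic t) t := by
    intro g hg x hx
    have h1 : ContinuousWithinAt (fun τ => g x τ) (Set.Icc s₀ t) t :=
      (hg (x, t) ⟨hx, ht⟩).comp (f := fun τ : ℝ => (x, τ)) (by fun_prop)
        fun τ hτ => ⟨hx, hτ.1, hτ.2.trans ht.2⟩
    rwa [ContinuousWithinAt, nhdsWithin_Icc_eq_nhdsLE hts₀] at h1
  have hpI := Set.Ioo_subset_Icc_self hpmem
  have hev : ∀ᶠ τ in 𝓝[≤] t, s₀ < τ ∧ 0 < w p τ ∧ Θ p τ - B p τ ≤ β p t + ε / 3 ∧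
      (0 ≤ w q τ → -(-β q t + ε / 3) ≤ Θ q τ - B q τ) := by
    have e1 : ∀ᶠ τ in 𝓝[≤] t, s₀ < τ := mem_nhdsWithin_of_mem_nhds (Ioi_mem_nhds hts₀)
    have e2 := (hslice w hwC p hpI).eventually (lt_mem_nhds (show 0 < w p t by
      rw [hwp]; exact hzpos p (Set.Ioo_subset_Ico_self hpmem)))
    have e3 := ((hslice Θ hΘC p hpI).sub (hslice B hBC p hpI)).eventually
      (gt_mem_nhds (show Θ p t - B p t < β p t + ε / 3 by linarith))
    have e4 : ∀ᶠ τ in 𝓝[≤] t, 0 ≤ w q τ → -(-β q t + ε / 3) ≤ Θ q τ - B q τ := by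
      by_cases hwq : 0 ≤ w q t
      · have := ((hslice Θ hΘC q hq).sub (hslice B hBC q hq)).eventually
          (lt_mem_nhds (show -(-β q t + ε / 3) < Θ q t - B q t by linarith [hΓq hwq]))
        exact this.mono fun τ hτ _ => le_of_lt hτ
      · exact ((hslice w hwC q hq).eventually (gt_mem_nhds (not_le.1 hwq))).mono
          fun τ hτ h0 => absurd h0 (not_le.2 hτ)
    filter_upwards [e1, e2, e3, e4] with τ h1 h2 h3 h4
    exact ⟨h1, h2, le_of_lt h3, h4⟩
  obtain ⟨s, hst, hsub⟩ := mem_nhdsLE_iff_exists_Icc_subset.1 hev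
  have hst' : s < t := hst
  have hIcc : ∀ τ ∈ Set.Icc s t, τ ∈ Set.Ioc s₀ s₁ := fun τ hτ =>
    ⟨(hsub hτ).1, hτ.2.trans ht.2⟩
  have hIcc' : ∀ τ ∈ Set.Icc s t, τ ∈ Set.Icc s₀ s₁ := fun τ hτ =>
    Set.Ioc_subset_Icc_self (hIcc τ hτ)
  have hpqsub : Set.Icc p q ⊆ Set.Icc m e := Set.Icc_subset_Icc hp.1 hq.2
  have hwτ : ∀ τ ∈ Set.Icc s t, ContinuousOn (fun x => w x τ) (Set.Icc p q) := fun τ hτ =>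
    hwC.comp (f := fun x : ℝ => (x, τ)) (by fun_prop) fun x hx => ⟨hpqsub hx, hIcc' τ hτ⟩
  have hβpq := hβ t ht hp hq hpq
  have hβq := hβ t ht hq ⟨hme.le, le_rfl⟩ hq.2
  simp only [hβe t ht] at hβpq hβq
  have hV := integral_max_evolution_lower_bound_of_continuousOn hpq' hst'.le
    (hyC.mono (Set.prod_mono hpqsub hIcc')) (fun τ hτ x hx => hy τ (hIcc' τ hτ) x (hpqsub hx)) hwτ
    (fun τ hτ x hx => hΘ τ (hIcc τ hτ) x (hpqsub hx)) (fun τ hτ => (hB τ (hIcc' τ hτ)).mono hpqsub)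
    (fun τ hτ x hx => hzero τ (hIcc' τ hτ) x (hpqsub hx)) (fun τ hτ => (hsub hτ).2.1)
    (fun τ hτ => (hsub hτ).2.2.1) (fun τ hτ => (hsub hτ).2.2.2) (by linarith)
  have hsplit : ∀ τ ∈ Set.Icc s t, H q τ - H p τ =
      (∫ x in p..q, z x) - ∫ x in p..q, max (w x τ) 0 := by
    intro τ hτ
    rw [hHsub, ← intervalIntegral.integral_sub]
    · refine intervalIntegral.integral_congr fun x hx => ?_
      rw [Set.uIcc_of_le hpq] at hx
      exact heq τ (hIcc' τ hτ) x (hpqsub hx)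
    · exact (hzC.mono (by rwa [Set.uIcc_of_le hpq])).intervalIntegrable
    · exact intervalIntegrable_max_zero (hwτ τ hτ) le_rfl hpq le_rfl
  have hJs := hJmax p q s hp hq (hIcc' s ⟨le_rfl, hst'.le⟩) hpq
  rw [hsplit s ⟨le_rfl, hst'.le⟩, hsplit t ⟨hst'.le, le_rfl⟩] at hJs
  nlinarith

end Collar

section Calculus

open Filter Topology

theorem hasDerivAt_along_line {f fx ft : ℝ → ℝ → ℝ} {b c s : ℝ}
    (hx : ∀ᶠ P in 𝓝 (b + c * s, s), HasDerivAt (fun x => f x P.2) (fx P.1 P.2) P.1)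
    (ht : ∀ᶠ P in 𝓝 (b + c * s, s), HasDerivAt (fun σ => f P.1 σ) (ft P.1 P.2) P.2)
    (hxC : ContinuousAt (fun P : ℝ × ℝ => fx P.1 P.2) (b + c * s, s))
    (htC : ContinuousAt (fun P : ℝ × ℝ => ft P.1 P.2) (b + c * s, s)) :
    HasDerivAt (fun σ => f (b + c * σ) σ) (c * fx (b + c * s) s + ft (b + c * s) s) s := by
  have hL : Continuous fun v : ℝ => ContinuousLinearMap.toSpanSingleton ℝ v :=
    (ContinuousLinearMap.toSpanSingletonCLE (𝕜 := ℝ) (E := ℝ)).continuous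
  have hF := (hasStrictFDerivAt_uncurry_coprod (𝕜 := ℝ) (u := (b + c * s, s)) (f := f)
    (f₁ := fun x σ => ContinuousLinearMap.toSpanSingleton ℝ (fx x σ))
    (f₂ := fun x σ => ContinuousLinearMap.toSpanSingleton ℝ (ft x σ))
    (hx.mono fun P hP => hP.hasFDerivAt) (ht.mono fun P hP => hP.hasFDerivAt)
    (hL.continuousAt.comp hxC) (hL.continuousAt.comp htC)).hasFDerivAt
  have hline : HasDerivAt (fun σ : ℝ => (b + c * σ, σ)) (c, 1) s :=
    (by simpa using ((hasDerivAt_id s).const_mul c).const_add b :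
      HasDerivAt (fun σ : ℝ => b + c * σ) c s).prodMk (hasDerivAt_id s)
  refine ((HasFDerivAt.comp_hasDerivAt (f := fun σ : ℝ => (b + c * σ, σ)) s hF hline).congr_deriv ?_)
  simp [Function.HasUncurry.uncurry]

theorem mixed_partials_eq_of_box {f fx ft fxt ftx : ℝ → ℝ → ℝ} {x t d : ℝ} (hd : 0 < d)
    (hfx : ∀ a ∈ Set.Icc x (x + d), ∀ b ∈ Set.Icc t (t + d), HasDerivAt (fun ρ => f ρ b) (fx a b) a)
    (hft : ∀ a ∈ Set.Icc x (x + d), ∀ b ∈ Set.Icc t (t + d),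
      HasDerivWithinAt (fun σ => f a σ) (ft a b) (Set.Icc t (t + d)) b)
    (hfxt : ∀ a ∈ Set.Icc x (x + d), ∀ b ∈ Set.Icc t (t + d),
      HasDerivWithinAt (fun σ => fx a σ) (fxt a b) (Set.Icc t (t + d)) b)
    (hftx : ∀ a ∈ Set.Icc x (x + d), ∀ b ∈ Set.Icc t (t + d),
      HasDerivAt (fun ρ => ft ρ b) (ftx a b) a)
    (hfxtC : ContinuousWithinAt (fun P : ℝ × ℝ => fxt P.1 P.2)
      (Set.Icc x (x + d) ×ˢ Set.Icc t (t + d)) (x, t))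
    (hftxC : ContinuousWithinAt (fun P : ℝ × ℝ => ftx P.1 P.2)
      (Set.Icc x (x + d) ×ˢ Set.Icc t (t + d)) (x, t)) :
    fxt x t = ftx x t := by
  by_contra hne
  have hpos : 0 < |fxt x t - ftx x t| / 2 := half_pos (abs_pos.2 (sub_ne_zero.2 hne))
  obtain ⟨d₁, hd₁, h₁⟩ := Metric.continuousWithinAt_iff.1 hfxtC _ hpos
  obtain ⟨d₂, hd₂, h₂⟩ := Metric.continuousWithinAt_iff.1 hftxC _ hpos
  set h := min d (min d₁ d₂ / 2) with hh
  have hh0 : 0 < h := by positivity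
  have hhd : h ≤ d := min_le_left _ _
  have hh12 : h ≤ min d₁ d₂ / 2 := min_le_right _ _
  have hhd₁ : h < d₁ := by linarith [min_le_left d₁ d₂]
  have hhd₂ : h < d₂ := by linarith [min_le_right d₁ d₂]
  have hxm : ∀ a ∈ Set.Icc x (x + h), a ∈ Set.Icc x (x + d) := fun a ha =>
    ⟨ha.1, by linarith [ha.2]⟩
  have htm : ∀ b ∈ Set.Icc t (t + h), b ∈ Set.Icc t (t + d) := fun b hb =>
    ⟨hb.1, by linarith [hb.2]⟩
  have hIoo : ∀ b ∈ Set.Ioo t (t + h), Set.Icc t (t + d) ∈ 𝓝 b := fun b hb =>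
    Icc_mem_nhds hb.1 (by linarith [hb.2])
  have hxl : x ∈ Set.Icc x (x + h) := ⟨le_rfl, by linarith⟩
  have hxr : x + h ∈ Set.Icc x (x + h) := ⟨by linarith, le_rfl⟩
  have htl : t ∈ Set.Icc t (t + h) := ⟨le_rfl, by linarith⟩
  have htr : t + h ∈ Set.Icc t (t + h) := ⟨by linarith, le_rfl⟩
  obtain ⟨a, ha, ha'⟩ := exists_hasDerivAt_eq_slope (fun ρ => f ρ (t + h) - f ρ t)
    (fun ρ => fx ρ (t + h) - fx ρ t) (show x < x + h by linarith)
    (fun ρ hρ => ((hfx ρ (hxm ρ hρ) _ (htm _ htr)).sub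
      (hfx ρ (hxm ρ hρ) _ (htm _ htl))).continuousAt.continuousWithinAt)
    (fun ρ hρ => (hfx ρ (hxm ρ (Set.Ioo_subset_Icc_self hρ)) _ (htm _ htr)).sub
      (hfx ρ (hxm ρ (Set.Ioo_subset_Icc_self hρ)) _ (htm _ htl)))
  have haI := Set.Ioo_subset_Icc_self ha
  obtain ⟨b, hb, hb'⟩ := exists_hasDerivAt_eq_slope (fun σ => fx a σ) (fun σ => fxt a σ)
    (show t < t + h by linarith)
    (fun σ hσ => ((hfxt a (hxm a haI) σ (htm σ hσ)).mono htm).continuousWithinAt)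
    (fun σ hσ => (hfxt a (hxm a haI) σ (htm σ (Set.Ioo_subset_Icc_self hσ))).hasDerivAt
      (hIoo σ hσ))
  obtain ⟨b₂, hb₂, hb₂'⟩ := exists_hasDerivAt_eq_slope (fun σ => f (x + h) σ - f x σ)
    (fun σ => ft (x + h) σ - ft x σ) (show t < t + h by linarith)
    (fun σ hσ => (((hft _ (hxm _ hxr) σ (htm σ hσ)).sub
      (hft _ (hxm _ hxl) σ (htm σ hσ))).mono htm).continuousWithinAt)
    (fun σ hσ => ((hft _ (hxm _ hxr) σ (htm σ (Set.Ioo_subset_Icc_self hσ))).sub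
      (hft _ (hxm _ hxl) σ (htm σ (Set.Ioo_subset_Icc_self hσ)))).hasDerivAt (hIoo σ hσ))
  have hbI₂ := Set.Ioo_subset_Icc_self hb₂
  obtain ⟨a₂, ha₂, ha₂'⟩ := exists_hasDerivAt_eq_slope (fun ρ => ft ρ b₂) (fun ρ => ftx ρ b₂)
    (show x < x + h by linarith)
    (fun ρ hρ => (hftx ρ (hxm ρ hρ) _ (htm _ hbI₂)).continuousAt.continuousWithinAt)
    (fun ρ hρ => hftx ρ (hxm ρ (Set.Ioo_subset_Icc_self hρ)) _ (htm _ hbI₂))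
  have hclose : ∀ a ∈ Set.Icc x (x + h), ∀ b ∈ Set.Icc t (t + h), ∀ r, h < r →
      dist (a, b) (x, t) < r := by
    intro a ha b hb r hr
    rw [Prod.dist_eq, max_lt_iff, Real.dist_eq, Real.dist_eq, abs_of_nonneg (by linarith [ha.1]),
      abs_of_nonneg (by linarith [hb.1])]
    constructor <;> linarith [ha.2, hb.2]
  have k₁ := h₁ (x := (a, b)) ⟨hxm a haI, htm b (Set.Ioo_subset_Icc_self hb)⟩
    (hclose a haI b (Set.Ioo_subset_Icc_self hb) _ hhd₁)
  have k₂ := h₂ (x := (a₂, b₂)) ⟨hxm a₂ (Set.Ioo_subset_Icc_self ha₂), htm b₂ hbI₂⟩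
    (hclose a₂ (Set.Ioo_subset_Icc_self ha₂) b₂ hbI₂ _ hhd₂)
  have heq : fxt a b = ftx a₂ b₂ := by
    rw [hb', ha₂', ha', hb₂']
    simp only [add_sub_cancel_left]
    ring
  rw [dist_comm, Real.dist_eq] at k₁
  rw [Real.dist_eq] at k₂
  have h3 := abs_sub_le (fxt x t) (fxt a b) (ftx x t)
  simp only at k₁ k₂
  rw [heq] at h3 k₁
  linarith

theorem forall_Icc_of_local_extension {P : ℝ → Prop} {a b : ℝ}
    (hclosed : IsClosed {t | t ∈ Set.Icc a b ∧ P t}) (ha : P a)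
    (hstep : ∀ t ∈ Set.Ico a b, (∀ s ∈ Set.Icc a t, P s) →
      ∃ h > t, ∀ s ∈ Set.Icc t h, s ≤ b → P s) :
    ∀ t ∈ Set.Icc a b, P t := by
  by_contra! hcon
  obtain ⟨t₀, ht₀, hPt₀⟩ := hcon
  set bad : Set ℝ := {t | t ∈ Set.Icc a b ∧ ¬ P t} with hbad
  have hne : bad.Nonempty := ⟨t₀, ht₀, hPt₀⟩
  have hbdd : BddBelow bad := ⟨a, fun t ht => ht.1.1⟩
  set t := sInf bad with ht
  have hat : a ≤ t := le_csInf hne fun s hs => hs.1.1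
  have htt₀ : t ≤ t₀ := csInf_le hbdd ⟨ht₀, hPt₀⟩
  have hbefore : ∀ s, a ≤ s → s < t → P s := fun s has hst => by
    by_contra hPs
    exact absurd (csInf_le hbdd ⟨⟨has, hst.le.trans (htt₀.trans ht₀.2)⟩, hPs⟩) (not_le.2 hst)
  have hPt : P t := by
    rcases hat.eq_or_lt with h | h
    · rwa [← h]
    · have hcl : t ∈ closure (Set.Ico a t) := by
        rw [closure_Ico h.ne]; exact ⟨hat, le_rfl⟩
      exact (hclosed.closure_subset_iff.2 (fun s hs =>
        ⟨⟨hs.1, hs.2.le.trans (htt₀.trans ht₀.2)⟩, hbefore s hs.1 hs.2⟩) hcl).2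
  have htlt : t < t₀ := lt_of_le_of_ne htt₀ (by rintro h; exact hPt₀ (h ▸ hPt))
  obtain ⟨h, hh, hext⟩ := hstep t ⟨hat, htlt.trans_le ht₀.2⟩ fun s hs => by
    rcases hs.2.eq_or_lt with h | h
    · rwa [h]
    · exact hbefore s hs.1 h
  obtain ⟨s, hs, hsh⟩ := exists_lt_of_csInf_lt hne hh
  exact hs.2 (hext s ⟨csInf_le hbdd hs, hsh.le⟩ hs.1.2)

end Calculus

/-- A flux `φ₁` with derivatives `φ₂`, `φ₃` which is increasing on `[0, 1]` and decreasing on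
`[1, ∞)`, with a nondegenerate maximum at `1`. -/
structure IsForwardBackwardFlux (φ₁ φ₂ φ₃ : ℝ → ℝ) : Prop where
  hasDerivAt : ∀ v, HasDerivAt φ₁ (φ₂ v) v
  hasDerivAt' : ∀ v, HasDerivAt φ₂ (φ₃ v) v
  continuous' : Continuous φ₃
  zero : φ₁ 0 = 0
  pos : ∀ v, 0 ≤ v → v < 1 → 0 < φ₂ v
  one : φ₂ 1 = 0
  neg : ∀ v, 1 < v → φ₂ v < 0
  one' : φ₃ 1 < 0

namespace IsForwardBackwardFlux

variable {φ₁ φ₂ φ₃ : ℝ → ℝ}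

theorem continuous₁ (hφ : IsForwardBackwardFlux φ₁ φ₂ φ₃) : Continuous φ₁ :=
  continuous_iff_continuousAt.2 fun v => (hφ.hasDerivAt v).continuousAt

theorem continuous₂ (hφ : IsForwardBackwardFlux φ₁ φ₂ φ₃) : Continuous φ₂ :=
  continuous_iff_continuousAt.2 fun v => (hφ.hasDerivAt' v).continuousAt

theorem le_one (hφ : IsForwardBackwardFlux φ₁ φ₂ φ₃) {v : ℝ} (hv : 0 ≤ v) : φ₁ v ≤ φ₁ 1 := by
  rcases le_total v 1 with h | h
  · refine monotoneOn_of_hasDerivWithinAt_nonneg (convex_Icc 0 1) hφ.continuous₁.continuousOn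
      (fun x _ => (hφ.hasDerivAt x).hasDerivWithinAt) (fun x hx => ?_) ⟨hv, h⟩ (by simp) h
    rw [interior_Icc] at hx
    exact (hφ.pos x hx.1.le hx.2).le
  · refine antitoneOn_of_hasDerivWithinAt_nonpos (convex_Ici 1) hφ.continuous₁.continuousOn
      (fun x _ => (hφ.hasDerivAt x).hasDerivWithinAt) (fun x hx => ?_) (Set.mem_Ici.2 le_rfl) h h
    rw [interior_Ici] at hx
    exact (hφ.neg x hx).le

theorem one_pos (hφ : IsForwardBackwardFlux φ₁ φ₂ φ₃) : 0 < φ₁ 1 := by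
  have := strictMonoOn_of_hasDerivWithinAt_pos (convex_Icc (0 : ℝ) 1) hφ.continuous₁.continuousOn
    (fun x _ => (hφ.hasDerivAt x).hasDerivWithinAt) (fun x hx => by
      rw [interior_Icc] at hx
      exact hφ.pos x hx.1.le hx.2) (a := 0) (b := 1) (by simp) (by simp) zero_lt_one
  rwa [hφ.zero] at this

end IsForwardBackwardFlux

/-- A `C¹` solution of `u_t = (φ₁(u_r))_r + φ₁(u_r) / r` on `(r₁, r₂) × [0, T)` with the
regularity `C³` in `r` and continuous `u_rt` off the critical set `|u_r| = 1`. -/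
structure IsRadialSolution (φ₁ : ℝ → ℝ) (r₁ r₂ T : ℝ)
    (u ur ut urr urrr urt : ℝ → ℝ → ℝ) : Prop where
  hasDerivAt : ∀ r t : ℝ, r ∈ Set.Ioo r₁ r₂ → t ∈ Set.Ico 0 T →
    HasDerivAt (fun ρ => u ρ t) (ur r t) r
  hasDerivWithinAt : ∀ r t : ℝ, r ∈ Set.Ioo r₁ r₂ → t ∈ Set.Ico 0 T →
    HasDerivWithinAt (fun s => u r s) (ut r t) (Set.Ico 0 T) t
  continuousOn : ContinuousOn (fun p : ℝ × ℝ => u p.1 p.2) (Set.Ioo r₁ r₂ ×ˢ Set.Ico 0 T)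
  continuousOn_ur : ContinuousOn (fun p : ℝ × ℝ => ur p.1 p.2) (Set.Ioo r₁ r₂ ×ˢ Set.Ico 0 T)
  continuousOn_ut : ContinuousOn (fun p : ℝ × ℝ => ut p.1 p.2) (Set.Ioo r₁ r₂ ×ˢ Set.Ico 0 T)
  equation : ∀ r t : ℝ, r ∈ Set.Ioo r₁ r₂ → t ∈ Set.Ico 0 T →
    HasDerivAt (fun ρ => φ₁ (ur ρ t)) (ut r t - φ₁ (ur r t) / r) r
  hasDerivAt_ur : ∀ r t : ℝ, r ∈ Set.Ioo r₁ r₂ → t ∈ Set.Ico 0 T → |ur r t| ≠ 1 →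
    HasDerivAt (fun ρ => ur ρ t) (urr r t) r
  hasDerivAt_urr : ∀ r t : ℝ, r ∈ Set.Ioo r₁ r₂ → t ∈ Set.Ico 0 T → |ur r t| ≠ 1 →
    HasDerivAt (fun ρ => urr ρ t) (urrr r t) r
  hasDerivWithinAt_ur : ∀ r t : ℝ, r ∈ Set.Ioo r₁ r₂ → t ∈ Set.Ico 0 T → |ur r t| ≠ 1 →
    HasDerivWithinAt (fun s => ur r s) (urt r t) (Set.Ico 0 T) t
  continuousOn_urr : ContinuousOn (fun p : ℝ × ℝ => urr p.1 p.2)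
    {p : ℝ × ℝ | p.1 ∈ Set.Ioo r₁ r₂ ∧ p.2 ∈ Set.Ico 0 T ∧ |ur p.1 p.2| ≠ 1}
  continuousOn_urrr : ContinuousOn (fun p : ℝ × ℝ => urrr p.1 p.2)
    {p : ℝ × ℝ | p.1 ∈ Set.Ioo r₁ r₂ ∧ p.2 ∈ Set.Ico 0 T ∧ |ur p.1 p.2| ≠ 1}
  continuousOn_urt : ContinuousOn (fun p : ℝ × ℝ => urt p.1 p.2)
    {p : ℝ × ℝ | p.1 ∈ Set.Ioo r₁ r₂ ∧ p.2 ∈ Set.Ico 0 T ∧ |ur p.1 p.2| ≠ 1}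

namespace IsRadialSolution

open Filter Topology

variable {φ₁ φ₂ φ₃ : ℝ → ℝ} {r₁ r₂ T : ℝ} {u ur ut urr urrr urt : ℝ → ℝ → ℝ}

theorem continuousAt_ur (hu : IsRadialSolution φ₁ r₁ r₂ T u ur ut urr urrr urt) {r t : ℝ}
    (hr : r ∈ Set.Ioo r₁ r₂) (ht : t ∈ Set.Ico 0 T) : ContinuousAt (fun ρ => ur ρ t) r := by
  have h : ContinuousOn (fun ρ => ur ρ t) (Set.Ioo r₁ r₂) :=
    hu.continuousOn_ur.comp (f := fun ρ : ℝ => (ρ, t)) (by fun_prop) fun ρ hρ => ⟨hρ, ht⟩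
  exact h.continuousAt (Ioo_mem_nhds hr.1 hr.2)

theorem ut_eq (hu : IsRadialSolution φ₁ r₁ r₂ T u ur ut urr urrr urt)
    (hφ : IsForwardBackwardFlux φ₁ φ₂ φ₃) {r t : ℝ} (hr : r ∈ Set.Ioo r₁ r₂)
    (ht : t ∈ Set.Ico 0 T) (hv : |ur r t| ≠ 1) :
    ut r t = φ₂ (ur r t) * urr r t + φ₁ (ur r t) / r := by
  have h1 := (hφ.hasDerivAt (ur r t)).comp r (hu.hasDerivAt_ur r t hr ht hv)
  have h2 := (hu.equation r t hr ht).unique h1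
  linarith

theorem ut_eq_of_ur_eq_one (hu : IsRadialSolution φ₁ r₁ r₂ T u ur ut urr urrr urt)
    (hφ : IsForwardBackwardFlux φ₁ φ₂ φ₃) {r t : ℝ} (hr : r ∈ Set.Ioo r₁ r₂)
    (ht : t ∈ Set.Ico 0 T) (hv : ur r t = 1) : ut r t = φ₁ 1 / r := by
  have hmax : IsLocalMax (fun ρ => φ₁ (ur ρ t)) r := by
    filter_upwards [(hu.continuousAt_ur hr ht).eventually (lt_mem_nhds (show 0 < ur r t by
      rw [hv]; exact one_pos))] with ρ hρ
    rw [hv]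
    exact hφ.le_one hρ.le
  have := hmax.hasDerivAt_eq_zero (hu.equation r t hr ht)
  rw [hv] at this
  linarith

/-- The equation satisfied by `u_r`, off the critical set. -/
theorem urt_eq (hu : IsRadialSolution φ₁ r₁ r₂ T u ur ut urr urrr urt)
    (hφ : IsForwardBackwardFlux φ₁ φ₂ φ₃) (hr₁ : 0 < r₁) {r t : ℝ} (hr : r ∈ Set.Ioo r₁ r₂)
    (ht : t ∈ Set.Ico 0 T) (hv : |ur r t| ≠ 1) :
    urt r t = φ₃ (ur r t) * urr r t ^ 2 + φ₂ (ur r t) * urrr r t + φ₂ (ur r t) * urr r t / r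
      - φ₁ (ur r t) / r ^ 2 := by
  set Ω : Set (ℝ × ℝ) := {p | p.1 ∈ Set.Ioo r₁ r₂ ∧ p.2 ∈ Set.Ico 0 T ∧ |ur p.1 p.2| ≠ 1} with hΩ
  have hev : ∀ᶠ p in 𝓝[Set.Ioo r₁ r₂ ×ˢ Set.Ico 0 T] (r, t), |ur p.1 p.2| ≠ 1 :=
    (hu.continuousOn_ur (r, t) ⟨hr, ht⟩).abs.eventually_ne hv
  obtain ⟨ε, hε, hball⟩ := Metric.mem_nhdsWithin_iff.1 hev
  obtain ⟨d, hd, hdε, hdr, hdt⟩ : ∃ d > 0, d < ε ∧ d < r₂ - r ∧ d < T - t := by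
    have h1 := hr.2
    have h2 := ht.2
    have h3 : 0 < min ε (min (r₂ - r) (T - t)) := by
      simp only [lt_min_iff, sub_pos]; exact ⟨hε, h1, h2⟩
    obtain ⟨d, hd0, hd⟩ := exists_between h3
    simp only [lt_min_iff] at hd
    exact ⟨d, hd0, hd.1, hd.2.1, hd.2.2⟩
  have hbox : ∀ a ∈ Set.Icc r (r + d), ∀ b ∈ Set.Icc t (t + d), (a, b) ∈ Ω := by
    intro a ha b hb
    have ha' : a ∈ Set.Ioo r₁ r₂ := ⟨hr.1.trans_le ha.1, by linarith [ha.2]⟩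
    have hb' : b ∈ Set.Ico 0 T := ⟨ht.1.trans hb.1, by linarith [hb.2]⟩
    refine ⟨ha', hb', hball ⟨?_, ha', hb'⟩⟩
    rw [Metric.mem_ball, Prod.dist_eq, max_lt_iff, Real.dist_eq, Real.dist_eq,
      abs_of_nonneg (by linarith [ha.1]), abs_of_nonneg (by linarith [hb.1])]
    constructor <;> linarith [ha.2, hb.2]
  have hsub : Set.Icc r (r + d) ×ˢ Set.Icc t (t + d) ⊆ Ω := fun p hp => hbox p.1 hp.1 p.2 hp.2
  have htsub : Set.Icc t (t + d) ⊆ Set.Ico 0 T := fun b hb =>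
    (hbox r ⟨le_rfl, by linarith⟩ b hb).2.1
  have hbase : (r, t) ∈ Set.Icc r (r + d) ×ˢ Set.Icc t (t + d) :=
    ⟨⟨le_rfl, by linarith⟩, ⟨le_rfl, by linarith⟩⟩
  refine mixed_partials_eq_of_box (f := u) (fx := ur) (ft := ut) (fxt := urt)
    (ftx := fun r t => φ₃ (ur r t) * urr r t ^ 2 + φ₂ (ur r t) * urrr r t
      + φ₂ (ur r t) * urr r t / r - φ₁ (ur r t) / r ^ 2) hd
    (fun a ha b hb => hu.hasDerivAt a b (hbox a ha b hb).1 (hbox a ha b hb).2.1)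
    (fun a ha b hb => (hu.hasDerivWithinAt a b (hbox a ha b hb).1 (hbox a ha b hb).2.1).mono htsub)
    (fun a ha b hb => (hu.hasDerivWithinAt_ur a b (hbox a ha b hb).1 (hbox a ha b hb).2.1
      (hbox a ha b hb).2.2).mono htsub) (fun a ha b hb => ?_)
    ((hu.continuousOn_urt.mono hsub) _ hbase) ?_
  · obtain ⟨ha', hb', hv'⟩ := hbox a ha b hb
    simp only at ha' hb' hv'
    have ha0 : a ≠ 0 := (hr₁.trans ha'.1).ne'
    have e1 := hu.hasDerivAt_ur a b ha' hb' hv'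
    have e2 := hu.hasDerivAt_urr a b ha' hb' hv'
    have e3 := (((hφ.hasDerivAt' (ur a b)).comp a e1).mul e2).add
      (((hφ.hasDerivAt (ur a b)).comp a e1).div (hasDerivAt_id a) ha0)
    refine (e3.congr_of_eventuallyEq ?_).congr_deriv ?_
    · filter_upwards [Ioo_mem_nhds ha'.1 ha'.2,
        (hu.continuousAt_ur ha' hb').abs.eventually_ne hv'] with ρ hρ1 hρ2
      exact hu.ut_eq hφ hρ1 hb' hρ2
    · simp only [Function.comp_apply, id]
      field_simp
      ring
  · have c1 : ContinuousOn (fun p : ℝ × ℝ => ur p.1 p.2) Ω :=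
      hu.continuousOn_ur.mono fun p hp => ⟨hp.1, hp.2.1⟩
    have c2 : ContinuousOn (fun p : ℝ × ℝ => urr p.1 p.2) Ω := hu.continuousOn_urr
    have c3 : ContinuousOn (fun p : ℝ × ℝ => urrr p.1 p.2) Ω := hu.continuousOn_urrr
    have c4 : ContinuousOn (fun p : ℝ × ℝ => p.1) Ω := continuousOn_fst
    have n4 : ∀ p ∈ Ω, p.1 ≠ 0 := fun p hp => (hr₁.trans hp.1.1).ne'
    have d1 := hφ.continuous₁.comp_continuousOn c1
    have d2 := hφ.continuous₂.comp_continuousOn c1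
    have d3 := hφ.continuous'.comp_continuousOn c1
    exact ((((d3.mul (c2.pow 2)).add (d2.mul c3)).add ((d2.mul c2).div c4 n4)).sub
      (d1.div (c4.pow 2) fun p hp => pow_ne_zero 2 (n4 p hp))).mono hsub _ hbase

theorem nhds_domain {r t : ℝ} (hr : r ∈ Set.Ioo r₁ r₂) (ht : t ∈ Set.Ioo 0 T) :
    Set.Ioo r₁ r₂ ×ˢ Set.Ico 0 T ∈ 𝓝 (r, t) :=
  prod_mem_nhds (Ioo_mem_nhds hr.1 hr.2) (Ico_mem_nhds ht.1 ht.2)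

theorem hasDerivAt_moving (hu : IsRadialSolution φ₁ r₁ r₂ T u ur ut urr urrr urt) {b c t : ℝ}
    (hr : b + c * t ∈ Set.Ioo r₁ r₂) (ht : t ∈ Set.Ioo 0 T) :
    HasDerivAt (fun s => u (b + c * s) s) (c * ur (b + c * t) t + ut (b + c * t) t) t := by
  have hN := nhds_domain hr ht
  refine hasDerivAt_along_line (Filter.mem_of_superset hN fun p hp => hu.hasDerivAt _ _ hp.1 hp.2)
    ?_ (hu.continuousOn_ur.continuousAt hN) (hu.continuousOn_ut.continuousAt hN)
  filter_upwards [prod_mem_nhds (Ioo_mem_nhds hr.1 hr.2) (Ioo_mem_nhds ht.1 ht.2)] with p hp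
  exact (hu.hasDerivWithinAt _ _ hp.1 (Set.Ioo_subset_Ico_self hp.2)).hasDerivAt
    (Ico_mem_nhds hp.2.1 hp.2.2)

theorem hasDerivAt_ur_moving (hu : IsRadialSolution φ₁ r₁ r₂ T u ur ut urr urrr urt) {b c t : ℝ}
    (hr : b + c * t ∈ Set.Ioo r₁ r₂) (ht : t ∈ Set.Ioo 0 T) (hv : |ur (b + c * t) t| ≠ 1) :
    HasDerivAt (fun s => ur (b + c * s) s)
      (c * urr (b + c * t) t + urt (b + c * t) t) t := by
  have hN : ∀ᶠ p : ℝ × ℝ in 𝓝 (b + c * t, t),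
      p.1 ∈ Set.Ioo r₁ r₂ ∧ p.2 ∈ Set.Ioo 0 T ∧ |ur p.1 p.2| ≠ 1 := by
    filter_upwards [prod_mem_nhds (Ioo_mem_nhds hr.1 hr.2) (Ioo_mem_nhds ht.1 ht.2),
      (hu.continuousOn_ur.continuousAt (nhds_domain hr ht)).abs.eventually_ne hv] with p h1 h2
    exact ⟨h1.1, h1.2, h2⟩
  have hN' : {p : ℝ × ℝ | p.1 ∈ Set.Ioo r₁ r₂ ∧ p.2 ∈ Set.Ico 0 T ∧ |ur p.1 p.2| ≠ 1} ∈
      𝓝 (b + c * t, t) := hN.mono fun p hp => ⟨hp.1, Set.Ioo_subset_Ico_self hp.2.1, hp.2.2⟩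
  refine hasDerivAt_along_line (hN.mono fun p hp => hu.hasDerivAt_ur _ _ hp.1
    (Set.Ioo_subset_Ico_self hp.2.1) hp.2.2) (hN.mono fun p hp => ?_)
    (hu.continuousOn_urr.continuousAt hN') (hu.continuousOn_urt.continuousAt hN')
  exact (hu.hasDerivWithinAt_ur _ _ hp.1 (Set.Ioo_subset_Ico_self hp.2.1) hp.2.2).hasDerivAt
    (Ico_mem_nhds hp.2.1.1 hp.2.1.2)

end IsRadialSolution

/-- Mirror image of `le_of_collar_contact`, with the barrier vanishing at the left endpoint. -/
theorem le_of_collar_contact_left {m e s₀ s₁ : ℝ} {y w Θ B β : ℝ → ℝ → ℝ} {z z' : ℝ → ℝ}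
    (hme : e < m) (hs : s₀ ≤ s₁)
    (hyC : ContinuousOn (fun P : ℝ × ℝ => y P.1 P.2) (Set.Icc e m ×ˢ Set.Icc s₀ s₁))
    (hwC : ContinuousOn (fun P : ℝ × ℝ => w P.1 P.2) (Set.Icc e m ×ˢ Set.Icc s₀ s₁))
    (hΘC : ContinuousOn (fun P : ℝ × ℝ => Θ P.1 P.2) (Set.Icc e m ×ˢ Set.Icc s₀ s₁))
    (hBC : ContinuousOn (fun P : ℝ × ℝ => B P.1 P.2) (Set.Icc e m ×ˢ Set.Icc s₀ s₁))
    (hy : ∀ τ ∈ Set.Icc s₀ s₁, ∀ x ∈ Set.Icc e m, HasDerivAt (fun ξ => y ξ τ) (w x τ) x)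
    (hΘ : ∀ τ ∈ Set.Ioc s₀ s₁, ∀ x ∈ Set.Icc e m, HasDerivAt (fun σ => y x σ) (Θ x τ) τ)
    (hB : ∀ τ ∈ Set.Icc s₀ s₁, MonotoneOn (fun x => B x τ) (Set.Icc e m))
    (hzero : ∀ τ ∈ Set.Icc s₀ s₁, ∀ x ∈ Set.Icc e m, w x τ = 0 → Θ x τ = B x τ)
    (hcontact : ∀ τ ∈ Set.Ioc s₀ s₁, ∀ x ∈ Set.Ioo e m, w x τ = z x →
      ∃ w', HasDerivAt (fun ξ => w ξ τ) w' x ∧ (z' x ≤ w' → β x τ ≤ Θ x τ - B x τ) ∧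
        (w' ≤ z' x → Θ x τ - B x τ ≤ β x τ))
    (hβ : ∀ τ ∈ Set.Icc s₀ s₁, MonotoneOn (fun x => β x τ) (Set.Icc e m))
    (hβe : ∀ τ ∈ Set.Icc s₀ s₁, β e τ = 0)
    (hzC : ContinuousOn z (Set.Icc e m)) (hz : ∀ x ∈ Set.Ioo e m, HasDerivAt z (z' x) x)
    (hzpos : ∀ x ∈ Set.Ioc e m, 0 < z x) (hze : z e = 0)
    (hwm : ∀ τ ∈ Set.Icc s₀ s₁, z m < w m τ) (hinit : ∀ x ∈ Set.Icc e m, z x ≤ w x s₀) :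
    ∀ τ ∈ Set.Icc s₀ s₁, ∀ x ∈ Set.Icc e m, z x ≤ w x τ := by
  have hmem : ∀ x ∈ Set.Icc (-m) (-e), -x ∈ Set.Icc e m := fun x hx =>
    ⟨by linarith [hx.2], by linarith [hx.1]⟩
  have hmem' : ∀ x ∈ Set.Ioo (-m) (-e), -x ∈ Set.Ioo e m := fun x hx =>
    ⟨by linarith [hx.2], by linarith [hx.1]⟩
  have hcomp : ∀ g : ℝ → ℝ → ℝ, ContinuousOn (fun P : ℝ × ℝ => g P.1 P.2)
      (Set.Icc e m ×ˢ Set.Icc s₀ s₁) → ContinuousOn (fun P : ℝ × ℝ => g (-P.1) P.2)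
      (Set.Icc (-m) (-e) ×ˢ Set.Icc s₀ s₁) := fun g hg =>
    hg.comp (f := fun P : ℝ × ℝ => (-P.1, P.2)) (by fun_prop) fun P hP => ⟨hmem _ hP.1, hP.2⟩
  have hneg : ∀ g : ℝ → ℝ, MonotoneOn g (Set.Icc e m) →
      MonotoneOn (fun x => -g (-x)) (Set.Icc (-m) (-e)) := fun g hg a ha b hb hab =>
    neg_le_neg (hg (hmem b hb) (hmem a ha) (neg_le_neg hab))
  have key := le_of_collar_contact (m := -m) (e := -e) (y := fun x τ => -y (-x) τ)
    (w := fun x τ => w (-x) τ) (Θ := fun x τ => -Θ (-x) τ) (B := fun x τ => -B (-x) τ)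
    (β := fun x τ => -β (-x) τ) (z := fun x => z (-x)) (z' := fun x => -z' (-x)) (by linarith) hs
    (hcomp y hyC).neg (hcomp w hwC) (hcomp Θ hΘC).neg (hcomp B hBC).neg
    (fun τ hτ x hx => by
      exact ((hy τ hτ (-x) (hmem x hx)).comp x (hasDerivAt_neg x)).neg.congr_deriv (by simp))
    (fun τ hτ x hx => (hΘ τ hτ (-x) (hmem x hx)).neg)
    (fun τ hτ => hneg _ (hB τ hτ)) (fun τ hτ x hx h0 => by rw [hzero τ hτ (-x) (hmem x hx) h0])
    (fun τ hτ x hx h0 => by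
      obtain ⟨w', h1, h2, h3⟩ := hcontact τ hτ (-x) (hmem' x hx) h0
      refine ⟨-w', ?_, fun h => ?_, fun h => ?_⟩
      · exact (h1.comp x (hasDerivAt_neg x)).congr_deriv (by simp)
      · linarith [h3 (by linarith)]
      · linarith [h2 (by linarith)])
    (fun τ hτ => hneg _ (hβ τ hτ)) (fun τ hτ => by simp [hβe τ hτ])
    (hzC.comp continuous_neg.continuousOn fun x hx => hmem x hx)
    (fun x hx => by
      exact ((hz (-x) (hmem' x hx)).comp x (hasDerivAt_neg x)).congr_deriv (by simp))
    (fun x hx => hzpos (-x) ⟨by linarith [hx.2], by linarith [hx.1]⟩) (by simpa using hze)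
    (fun τ hτ => by simpa using hwm τ hτ) (fun x hx => hinit (-x) (hmem x hx))
  intro τ hτ x hx
  simpa using key τ hτ (-x) ⟨by linarith [hx.2], by linarith [hx.1]⟩

namespace IsRadialSolution

open Filter Topology

variable {φ₁ φ₂ φ₃ : ℝ → ℝ} {r₁ r₂ T : ℝ} {u ur ut urr urrr urt : ℝ → ℝ → ℝ}

theorem lt_of_barrier_le (hu : IsRadialSolution φ₁ r₁ r₂ T u ur ut urr urrr urt)
    (hφ : IsForwardBackwardFlux φ₁ φ₂ φ₃) (hr₁ : 0 < r₁) {b c t : ℝ} {z z' : ℝ → ℝ} {ξ zd : ℝ}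
    (ht : t ∈ Set.Ioo 0 T) (hR : b + ξ + c * t ∈ Set.Ioo r₁ r₂)
    (hz : ∀ᶠ x in 𝓝 ξ, HasDerivAt z (z' x) x) (hz' : HasDerivAt z' zd ξ)
    (hz0 : 0 < z ξ) (hz1 : z ξ < 1)
    (hbar : 0 < -φ₃ (1 - z ξ) * z' ξ ^ 2 + φ₂ (1 - z ξ) * zd + c * z' ξ
      + φ₂ (1 - z ξ) * z' ξ / (b + ξ + c * t) + φ₁ (1 - z ξ) / (b + ξ + c * t) ^ 2)
    (hle : ∀ᶠ x in 𝓝 ξ, z x ≤ 1 - ur (b + x + c * t) t)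
    (hbefore : ∀ᶠ s in 𝓝[<] t, z ξ ≤ 1 - ur (b + ξ + c * s) s) :
    z ξ < 1 - ur (b + ξ + c * t) t := by
  refine lt_of_le_of_ne hle.self_of_nhds fun heq => ?_
  set R := b + ξ + c * t with hRdef
  have hv : ur R t = 1 - z ξ := by linarith
  have hvne : |ur R t| ≠ 1 := by
    rw [hv, abs_of_pos (by linarith)]; linarith
  have htI := Set.Ioo_subset_Ico_self ht
  have hshift : ∀ x, HasDerivAt (fun x => b + x + c * t) 1 x := fun x => by
    simpa using ((hasDerivAt_id x).const_add b).add_const (c * t)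
  have hmin : IsLocalMin (fun x => 1 - ur (b + x + c * t) t - z x) ξ := by
    filter_upwards [hle] with x hx
    linarith
  have hshiftC : ContinuousAt (fun x => b + x + c * t) ξ := (hshift ξ).continuousAt
  have hnear : ∀ᶠ x in 𝓝 ξ, b + x + c * t ∈ Set.Ioo r₁ r₂ ∧ |ur (b + x + c * t) t| ≠ 1 := by
    have h1 := hshiftC.eventually (Ioo_mem_nhds hR.1 hR.2)
    have h2 := hshiftC.eventually ((hu.continuousAt_ur hR htI).abs.eventually_ne hvne)
    filter_upwards [h1, h2] with x h3 h4 using ⟨h3, h4⟩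
  have hderiv : ∀ᶠ x in 𝓝 ξ, HasDerivAt (fun x => 1 - ur (b + x + c * t) t - z x)
      (-urr (b + x + c * t) t - z' x) x := by
    filter_upwards [hnear, hz] with x hx hzx
    have := (hu.hasDerivAt_ur _ t hx.1 htI hx.2).comp x (hshift x)
    exact ((this.const_sub 1).sub hzx).congr_deriv (by ring)
  have hderiv2 : HasDerivAt (fun x => -urr (b + x + c * t) t - z' x) (-urrr R t - zd) ξ := by
    have := (hu.hasDerivAt_urr R t hR htI hvne).comp ξ (hshift ξ)
    exact (this.neg.sub hz').congr_deriv (by ring)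
  have e1 : -urr R t - z' ξ = 0 := hmin.hasDerivAt_eq_zero hderiv.self_of_nhds
  have e2 := hmin.nonneg_of_hasDerivAt_deriv hderiv hderiv2
  have e3 := hu.urt_eq hφ hr₁ hR htI hvne
  rw [hv, show urr R t = -z' ξ by linarith] at e3
  have e4 := hu.hasDerivAt_ur_moving (b := b + ξ) (c := c) hR ht hvne
  rw [show urr (b + ξ + c * t) t = -z' ξ by linarith] at e4
  obtain ⟨l, hl, hsub⟩ := mem_nhdsLT_iff_exists_Ioo_subset.1 hbefore
  have e5 := (e4.hasDerivWithinAt (s := Set.univ)).nonneg_of_forall_le_left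
    (show (l + t) / 2 < t by linarith [Set.mem_Iio.1 hl]) (Set.subset_univ _) fun s h1 h2 => by
      have := hsub (a := s) ⟨by linarith [Set.mem_Iio.1 hl], h2⟩
      simp only [Set.mem_ofPred_eq] at this
      linarith
  have e6 := mul_nonneg (hφ.pos (1 - z ξ) (by linarith) (by linarith)).le e2
  rw [← hRdef, e3] at e5
  have e7 : φ₂ (1 - z ξ) * -z' ξ / R = -(φ₂ (1 - z ξ) * z' ξ / R) := by ring
  rw [e7] at e5
  nlinarith

end IsRadialSolution

/-- The defect of the profile `z` in the equation satisfied by `1 - u_r` in a frame moving with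
velocity `c`. -/
noncomputable def barrierDefect (φ₁ φ₂ φ₃ z z' z'' : ℝ → ℝ) (c ξ ρ : ℝ) : ℝ :=
  -φ₃ (1 - z ξ) * z' ξ ^ 2 + φ₂ (1 - z ξ) * z'' ξ + c * z' ξ
    + φ₂ (1 - z ξ) * z' ξ / ρ + φ₁ (1 - z ξ) / ρ ^ 2

/-- A twice differentiable bump on `[-η, η]` with values in `[0, 1)`. -/
structure IsBump (z z' z'' : ℝ → ℝ) (η : ℝ) : Prop where
  hasDerivAt : ∀ ξ, HasDerivAt z (z' ξ) ξ
  hasDerivAt' : ∀ ξ, HasDerivAt z' (z'' ξ) ξ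
  left : z (-η) = 0
  right : z η = 0
  pos : ∀ ξ ∈ Set.Ioo (-η) η, 0 < z ξ
  lt_one : ∀ ξ ∈ Set.Ioo (-η) η, z ξ < 1

theorem IsBump.continuous {z z' z'' : ℝ → ℝ} {η : ℝ} (hz : IsBump z z' z'' η) : Continuous z :=
  continuous_iff_continuousAt.2 fun ξ => (hz.hasDerivAt ξ).continuousAt

namespace IsRadialSolution

open Filter Topology

variable {φ₁ φ₂ φ₃ : ℝ → ℝ} {r₁ r₂ T : ℝ} {u ur ut urr urrr urt : ℝ → ℝ → ℝ}

theorem continuousOn_moving {f : ℝ → ℝ → ℝ} {η b c t₀ t₁ : ℝ}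
    (hf : ContinuousOn (fun p : ℝ × ℝ => f p.1 p.2) (Set.Ioo r₁ r₂ ×ˢ Set.Ico 0 T))
    (ht₀ : 0 ≤ t₀) (ht₁ : t₁ < T)
    (hR : ∀ s ∈ Set.Icc t₀ t₁, ∀ ξ ∈ Set.Icc (-η) η, b + ξ + c * s ∈ Set.Ioo r₁ r₂) :
    ContinuousOn (fun P : ℝ × ℝ => f (b + P.1 + c * P.2) P.2)
      (Set.Icc (-η) η ×ˢ Set.Icc t₀ t₁) :=
  hf.comp (f := fun P : ℝ × ℝ => (b + P.1 + c * P.2, P.2)) (by fun_prop) fun P hP =>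
    ⟨hR _ hP.2 _ hP.1, ht₀.trans hP.2.1, hP.2.2.trans_lt ht₁⟩

/-- Comparison with the barrier propagates from the core `|ξ| ≤ θ` to the collars. -/
theorem barrier_le_on_collars (hu : IsRadialSolution φ₁ r₁ r₂ T u ur ut urr urrr urt)
    (hφ : IsForwardBackwardFlux φ₁ φ₂ φ₃) (hr₁ : 0 < r₁) {b c η θ t₀ t₁ : ℝ} {z z' z'' : ℝ → ℝ}
    (hz : IsBump z z' z'' η) (hθ : 0 < θ) (hθη : θ < η) (ht₀ : 0 ≤ t₀) (ht₀₁ : t₀ ≤ t₁)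
    (ht₁ : t₁ < T)
    (hR : ∀ s ∈ Set.Icc t₀ t₁, ∀ ξ ∈ Set.Icc (-η) η, b + ξ + c * s ∈ Set.Ioo r₁ r₂)
    (hbar : ∀ ξ, θ ≤ |ξ| → |ξ| ≤ η → ∀ ρ ∈ Set.Ioo r₁ r₂,
      φ₁ 1 / ρ ^ 2 ≤ barrierDefect φ₁ φ₂ φ₃ z z' z'' c ξ ρ)
    (hcore : ∀ s ∈ Set.Icc t₀ t₁, z θ < 1 - ur (b + θ + c * s) s ∧
      z (-θ) < 1 - ur (b + -θ + c * s) s)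
    (hinit : ∀ ξ ∈ Set.Icc (-η) η, z ξ ≤ 1 - ur (b + ξ + c * t₀) t₀) :
    ∀ s ∈ Set.Icc t₀ t₁, ∀ ξ ∈ Set.Icc (-η) η, θ ≤ |ξ| → z ξ ≤ 1 - ur (b + ξ + c * s) s := by
  have hT : ∀ s ∈ Set.Icc t₀ t₁, s ∈ Set.Ico 0 T := fun s hs =>
    ⟨ht₀.trans hs.1, hs.2.trans_lt ht₁⟩
  have hT' : ∀ s ∈ Set.Ioc t₀ t₁, s ∈ Set.Ioo 0 T := fun s hs =>
    ⟨ht₀.trans_lt hs.1, hs.2.trans_lt ht₁⟩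
  have hshift : ∀ s x : ℝ, HasDerivAt (fun x => b + x + c * s) 1 x := fun s x => by
    simpa using ((hasDerivAt_id x).const_add b).add_const (c * s)
  set y : ℝ → ℝ → ℝ := fun x s => (b + x + c * s) - u (b + x + c * s) s with hydef
  set w : ℝ → ℝ → ℝ := fun x s => 1 - ur (b + x + c * s) s with hwdef
  set Θ : ℝ → ℝ → ℝ := fun x s => c * (1 - ur (b + x + c * s) s) - ut (b + x + c * s) s with hΘdef
  set B : ℝ → ℝ → ℝ := fun x s => -(φ₁ 1 / (b + x + c * s)) with hBdef
  set β : ℝ → ℝ → ℝ := fun x s => φ₂ (1 - z x) * z' x + c * z x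
    - (φ₁ (1 - z x) - φ₁ 1) / (b + x + c * s) with hβdef
  have hC : ContinuousOn (fun P : ℝ × ℝ => b + P.1 + c * P.2)
      (Set.Icc (-η) η ×ˢ Set.Icc t₀ t₁) := by fun_prop
  have hurC := continuousOn_moving hu.continuousOn_ur ht₀ ht₁ hR
  have hyC : ContinuousOn (fun P : ℝ × ℝ => y P.1 P.2) (Set.Icc (-η) η ×ˢ Set.Icc t₀ t₁) :=
    hC.sub (continuousOn_moving hu.continuousOn ht₀ ht₁ hR)
  have hwC : ContinuousOn (fun P : ℝ × ℝ => w P.1 P.2) (Set.Icc (-η) η ×ˢ Set.Icc t₀ t₁) :=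
    continuousOn_const.sub hurC
  have hΘC : ContinuousOn (fun P : ℝ × ℝ => Θ P.1 P.2) (Set.Icc (-η) η ×ˢ Set.Icc t₀ t₁) :=
    (continuousOn_const.mul hwC).sub (continuousOn_moving hu.continuousOn_ut ht₀ ht₁ hR)
  have hBC : ContinuousOn (fun P : ℝ × ℝ => B P.1 P.2) (Set.Icc (-η) η ×ˢ Set.Icc t₀ t₁) :=
    (continuousOn_const.div hC fun P hP => (hr₁.trans (hR _ hP.2 _ hP.1).1).ne').neg
  have hy : ∀ s ∈ Set.Icc t₀ t₁, ∀ x ∈ Set.Icc (-η) η,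
      HasDerivAt (fun ξ => y ξ s) (w x s) x := fun s hs x hx => by
    have h1 := (hu.hasDerivAt _ s (hR s hs x hx) (hT s hs)).comp x (hshift s x)
    exact ((hshift s x).sub h1).congr_deriv (by simp [hwdef])
  have hΘ : ∀ s ∈ Set.Ioc t₀ t₁, ∀ x ∈ Set.Icc (-η) η,
      HasDerivAt (fun σ => y x σ) (Θ x s) s := fun s hs x hx => by
    have h1 : HasDerivAt (fun s => b + x + c * s) c s := by
      simpa using ((hasDerivAt_id s).const_mul c).const_add (b + x)
    exact (h1.sub (hu.hasDerivAt_moving (hR s (Set.Ioc_subset_Icc_self hs) x hx)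
      (hT' s hs))).congr_deriv (by simp only [hΘdef]; ring)
  have hB : ∀ s ∈ Set.Icc t₀ t₁, MonotoneOn (fun x => B x s) (Set.Icc (-η) η) :=
    fun s hs x hx x' hx' hxx' => by
      have h1 := hr₁.trans (hR s hs x hx).1
      have h2 := hφ.one_pos
      simp only [hBdef]
      gcongr
  have hzero : ∀ s ∈ Set.Icc t₀ t₁, ∀ x ∈ Set.Icc (-η) η, w x s = 0 → Θ x s = B x s :=
    fun s hs x hx h0 => by
      have h1 := hu.ut_eq_of_ur_eq_one hφ (hR s hs x hx) (hT s hs) (sub_eq_zero.1 h0).symm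
      simp only [hΘdef, hBdef, h1]
      simp only [hwdef] at h0
      rw [h0]
      ring
  have hcontact : ∀ s ∈ Set.Ioc t₀ t₁, ∀ x ∈ Set.Ioo (-η) η, w x s = z x →
      ∃ w', HasDerivAt (fun ξ => w ξ s) w' x ∧ (z' x ≤ w' → β x s ≤ Θ x s - B x s) ∧
        (w' ≤ z' x → Θ x s - B x s ≤ β x s) := fun s hs x hx h0 => by
    have hs' := Set.Ioc_subset_Icc_self hs
    have hx' := Set.Ioo_subset_Icc_self hx
    have h1 := hz.pos x hx
    have h2 := hz.lt_one x hx
    have hv : ur (b + x + c * s) s = 1 - z x := by simp only [hwdef] at h0; linarith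
    have hv' : |ur (b + x + c * s) s| ≠ 1 := by
      rw [hv, abs_of_pos (by linarith)]; linarith
    have h3 := hu.ut_eq hφ (hR s hs' x hx') (hT s hs') hv'
    have h4 : Θ x s - B x s - β x s
        = φ₂ (1 - z x) * (-urr (b + x + c * s) s - z' x) := by
      simp only [hΘdef, hBdef, hβdef, h3, hv]
      ring
    have h5 := (hφ.pos (1 - z x) (by linarith) (by linarith)).le
    refine ⟨-urr (b + x + c * s) s, ?_, fun h => ?_, fun h => ?_⟩
    · have h6 := (hu.hasDerivAt_ur _ s (hR s hs' x hx') (hT s hs') hv').comp x (hshift s x)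
      exact (h6.const_sub 1).congr_deriv (by simp)
    · nlinarith
    · nlinarith
  have hβd : ∀ s ∈ Set.Icc t₀ t₁, ∀ x ∈ Set.Icc (-η) η, HasDerivAt (fun ξ => β ξ s)
      (barrierDefect φ₁ φ₂ φ₃ z z' z'' c x (b + x + c * s) - φ₁ 1 / (b + x + c * s) ^ 2) x :=
    fun s hs x hx => by
      have h1 := (hr₁.trans (hR s hs x hx).1).ne'
      have h2 := (hz.hasDerivAt x).const_sub 1
      have h3 := (((hφ.hasDerivAt' (1 - z x)).comp x h2).mul (hz.hasDerivAt' x)).add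
        ((hz.hasDerivAt x).const_mul c)
      have h4 := (((hφ.hasDerivAt (1 - z x)).comp x h2).sub_const (φ₁ 1)).div (hshift s x) h1
      refine (h3.sub h4).congr_deriv ?_
      simp only [barrierDefect, Function.comp_apply]
      field_simp
      ring
  have hβmono : ∀ p q : ℝ, (∀ x ∈ Set.Icc p q, θ ≤ |x| ∧ |x| ≤ η) → ∀ s ∈ Set.Icc t₀ t₁,
      MonotoneOn (fun x => β x s) (Set.Icc p q) := fun p q hpq s hs => by
    have hsub : ∀ x ∈ Set.Icc p q, x ∈ Set.Icc (-η) η := fun x hx => abs_le.1 (hpq x hx).2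
    refine monotoneOn_of_hasDerivWithinAt_nonneg (convex_Icc p q)
      (fun x hx => (hβd s hs x (hsub x hx)).continuousAt.continuousWithinAt)
      (fun x hx => (hβd s hs x (hsub x (interior_subset hx))).hasDerivWithinAt) fun x hx => ?_
    have hx' := interior_subset hx
    exact sub_nonneg.2 (hbar x (hpq x hx').1 (hpq x hx').2 _ (hR s hs x (hsub x hx')))
  intro s hs ξ hξ hξθ
  rcases le_abs.1 hξθ with h | h
  · have hsub : Set.Icc θ η ⊆ Set.Icc (-η) η := Set.Icc_subset_Icc_left (by linarith)
    have hsub2 := Set.prod_mono_left (t := Set.Icc t₀ t₁) hsub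
    refine le_of_collar_contact (z' := z') (β := β) hθη ht₀₁ (hyC.mono hsub2) (hwC.mono hsub2)
      (hΘC.mono hsub2) (hBC.mono hsub2) (fun s hs x hx => hy s hs x (hsub hx))
      (fun s hs x hx => hΘ s hs x (hsub hx)) (fun s hs => (hB s hs).mono hsub)
      (fun s hs x hx => hzero s hs x (hsub hx))
      (fun s hs x hx => hcontact s hs x ⟨by linarith [hx.1], hx.2⟩)
      (hβmono θ η fun x hx => ?_) (fun s hs => ?_) hz.continuous.continuousOn
      (fun x _ => hz.hasDerivAt x) (fun x hx => hz.pos x ⟨by linarith [hx.1], hx.2⟩) hz.right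
      (fun s hs => (hcore s hs).1) (fun x hx => hinit x (hsub hx)) s hs ξ ⟨h, hξ.2⟩
    · rw [abs_of_nonneg (hθ.le.trans hx.1)]; exact hx
    · simp [hβdef, hz.right, hφ.one]
  · have hsub : Set.Icc (-η) (-θ) ⊆ Set.Icc (-η) η := Set.Icc_subset_Icc_right (by linarith)
    have hsub2 := Set.prod_mono_left (t := Set.Icc t₀ t₁) hsub
    refine le_of_collar_contact_left (z' := z') (β := β) (neg_lt_neg hθη) ht₀₁ (hyC.mono hsub2)
      (hwC.mono hsub2) (hΘC.mono hsub2) (hBC.mono hsub2) (fun s hs x hx => hy s hs x (hsub hx))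
      (fun s hs x hx => hΘ s hs x (hsub hx)) (fun s hs => (hB s hs).mono hsub)
      (fun s hs x hx => hzero s hs x (hsub hx))
      (fun s hs x hx => hcontact s hs x ⟨hx.1, by linarith [hx.2]⟩)
      (hβmono (-η) (-θ) fun x hx => ?_) (fun s hs => ?_) hz.continuous.continuousOn
      (fun x _ => hz.hasDerivAt x) (fun x hx => hz.pos x ⟨hx.1, by linarith [hx.2]⟩) hz.left
      (fun s hs => (hcore s hs).2) (fun x hx => hinit x (hsub hx)) s hs ξ ⟨hξ.1, by linarith⟩
    · rw [abs_of_nonpos (by linarith [hx.2])]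
      exact ⟨by linarith [hx.2], by linarith [hx.1]⟩
    · simp [hβdef, hz.left, hφ.one]

end IsRadialSolution

namespace IsRadialSolution

open Filter Topology

variable {φ₁ φ₂ φ₃ : ℝ → ℝ} {r₁ r₂ T : ℝ} {u ur ut urr urrr urt : ℝ → ℝ → ℝ}

theorem barrier_le (hu : IsRadialSolution φ₁ r₁ r₂ T u ur ut urr urrr urt)
    (hφ : IsForwardBackwardFlux φ₁ φ₂ φ₃) (hr₁ : 0 < r₁) {b c η θ t₁ : ℝ} {z z' z'' : ℝ → ℝ}
    (hz : IsBump z z' z'' η) (hθ : 0 < θ) (hθη : θ < η) (ht₁ : t₁ < T)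
    (hR : ∀ s ∈ Set.Icc 0 t₁, ∀ ξ ∈ Set.Icc (-η) η, b + ξ + c * s ∈ Set.Ioo r₁ r₂)
    (hbar : ∀ ξ, θ ≤ |ξ| → |ξ| ≤ η → ∀ ρ ∈ Set.Ioo r₁ r₂,
      φ₁ 1 / ρ ^ 2 ≤ barrierDefect φ₁ φ₂ φ₃ z z' z'' c ξ ρ)
    (hbar' : ∀ ξ, |ξ| ≤ η → ∀ ρ ∈ Set.Ioo r₁ r₂, 0 < barrierDefect φ₁ φ₂ φ₃ z z' z'' c ξ ρ)
    (hinit : ∀ ξ ∈ Set.Icc (-η) η, z ξ < 1 - ur (b + ξ) 0) :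
    ∀ s ∈ Set.Icc 0 t₁, ∀ ξ ∈ Set.Icc (-η) η, z ξ ≤ 1 - ur (b + ξ + c * s) s := by
  have hwC : ContinuousOn (fun P : ℝ × ℝ => 1 - ur (b + P.1 + c * P.2) P.2)
      (Set.Icc (-η) η ×ˢ Set.Icc 0 t₁) :=
    continuousOn_const.sub (continuousOn_moving hu.continuousOn_ur le_rfl ht₁ hR)
  refine forall_Icc_of_local_extension ?_ (fun ξ hξ => ?_) fun t ht hP => ?_
  · have hcl : ∀ ξ ∈ Set.Icc (-η) η,
        IsClosed {t ∈ Set.Icc 0 t₁ | z ξ ≤ 1 - ur (b + ξ + c * t) t} := fun ξ hξ =>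
      isClosed_Icc.isClosed_le continuousOn_const
        (hwC.comp (f := fun t : ℝ => (ξ, t)) (by fun_prop) fun t ht => ⟨hξ, ht⟩)
    convert isClosed_Icc.inter (isClosed_biInter hcl) (s₁ := Set.Icc 0 t₁) using 1
    ext t
    simp only [Set.mem_ofPred_eq, Set.mem_inter_iff, Set.mem_iInter]
    exact ⟨fun h => ⟨h.1, fun ξ hξ => ⟨h.1, h.2 ξ hξ⟩⟩, fun h => ⟨h.1, fun ξ hξ => (h.2 ξ hξ).2⟩⟩
  · simpa using (hinit ξ hξ).le
  have hT : t < T := ht.2.trans ht₁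
  have htt : t ∈ Set.Icc 0 t := ⟨ht.1, le_rfl⟩
  have htI : t ∈ Set.Icc 0 t₁ := ⟨ht.1, ht.2.le⟩
  have hstrict : ∀ ξ ∈ Set.Ioo (-η) η, z ξ < 1 - ur (b + ξ + c * t) t := fun ξ hξ => by
    have hξ' := Set.Ioo_subset_Icc_self hξ
    rcases ht.1.eq_or_lt with rfl | h0
    · simpa using hinit ξ hξ'
    refine hu.lt_of_barrier_le hφ hr₁ ⟨h0, hT⟩ (hR t htI ξ hξ')
      (Eventually.of_forall hz.hasDerivAt) (hz.hasDerivAt' ξ) (hz.pos ξ hξ) (hz.lt_one ξ hξ)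
      (hbar' ξ (abs_le.2 hξ') _ (hR t htI ξ hξ')) ?_ ?_
    · filter_upwards [Ioo_mem_nhds hξ.1 hξ.2] with x hx
      exact hP t htt x (Set.Ioo_subset_Icc_self hx)
    · filter_upwards [Ioo_mem_nhdsLT h0] with s hs
      exact hP s (Set.Ioo_subset_Icc_self hs) ξ hξ'
  have hcore : ∀ᶠ s in 𝓝 t, ∀ ξ ∈ Set.Icc (-θ) θ, s ∈ Set.Icc 0 t₁ →
      z ξ < 1 - ur (b + ξ + c * s) s := by
    refine isCompact_Icc.eventually_forall_of_forall_eventually fun ξ hξ => ?_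
    have hξ' : ξ ∈ Set.Ioo (-η) η := ⟨by linarith [hξ.1], by linarith [hξ.2]⟩
    have h1 : ContinuousOn (fun P : ℝ × ℝ => 1 - ur (b + P.2 + c * P.1) P.1 - z P.2)
        (Set.Icc 0 t₁ ×ˢ Set.Icc (-η) η) :=
      (hwC.comp (f := Prod.swap) continuous_swap.continuousOn fun P hP => ⟨hP.2, hP.1⟩).sub
        (hz.continuous.comp continuous_snd).continuousOn
    have h2 := (h1 (t, ξ) ⟨htI, Set.Ioo_subset_Icc_self hξ'⟩).eventually
      (lt_mem_nhds (sub_pos.2 (hstrict ξ hξ')))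
    rw [eventually_nhdsWithin_iff] at h2
    filter_upwards [h2, (continuous_snd.tendsto (t, ξ)).eventually
      (Ioo_mem_nhds hξ'.1 hξ'.2)] with P hP hP' hs
    exact sub_pos.1 (hP ⟨hs, Set.Ioo_subset_Icc_self hP'⟩)
  obtain ⟨ε, hε, hball⟩ := Metric.eventually_nhds_iff.1 hcore
  have hclose : ∀ s ∈ Set.Icc t (min (t + ε / 2) t₁), ∀ ξ ∈ Set.Icc (-θ) θ,
      z ξ < 1 - ur (b + ξ + c * s) s := fun s hs ξ hξ => by
    refine hball ?_ ξ hξ ⟨ht.1.trans hs.1, hs.2.trans (min_le_right _ _)⟩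
    rw [Real.dist_eq, abs_of_nonneg (by linarith [hs.1])]
    linarith [hs.2.trans (min_le_left _ _)]
  refine ⟨min (t + ε / 2) t₁, lt_min (by linarith) ht.2, fun s hs _ ξ hξ => ?_⟩
  rcases le_total θ |ξ| with h | h
  · refine hu.barrier_le_on_collars hφ hr₁ hz hθ hθη ht.1 (hs.1.trans hs.2)
      ((min_le_right _ _).trans_lt ht₁)
      (fun s hs => hR s ⟨ht.1.trans hs.1, hs.2.trans (min_le_right _ _)⟩) hbar
      (fun s hs => ⟨hclose s hs θ ⟨by linarith, le_rfl⟩, hclose s hs (-θ) ⟨le_rfl, by linarith⟩⟩)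
      (hP t htt) s hs ξ hξ h
  · exact (hclose s hs ξ (abs_le.1 h)).le

end IsRadialSolution

/-- Taylor bounds for the flux to the left of its maximum. -/
theorem IsForwardBackwardFlux.exists_taylor_bounds {φ₁ φ₂ φ₃ : ℝ → ℝ}
    (hφ : IsForwardBackwardFlux φ₁ φ₂ φ₃) :
    ∃ δ > 0, δ < 1 ∧ ∀ z ∈ Set.Icc 0 δ, 0.99 * -φ₃ 1 ≤ -φ₃ (1 - z) ∧ 0 ≤ φ₂ (1 - z) ∧
      φ₂ (1 - z) ≤ 1.01 * -φ₃ 1 * z ∧ -(1.01 * -φ₃ 1 * z ^ 2) ≤ φ₁ (1 - z) - φ₁ 1 := by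
  have hk := hφ.one'
  have hcont : ContinuousAt (fun z => -φ₃ (1 - z)) 0 :=
    (hφ.continuous'.comp (continuous_const.sub continuous_id)).neg.continuousAt
  obtain ⟨δ, hδ, hball⟩ := Metric.eventually_nhds_iff.1 (hcont.eventually (Icc_mem_nhds
    (show 0.99 * -φ₃ 1 < -φ₃ (1 - 0) by rw [sub_zero]; linarith)
    (show -φ₃ (1 - 0) < 1.01 * -φ₃ 1 by rw [sub_zero]; linarith)))
  obtain ⟨d, hd, hd'⟩ := exists_between (lt_min hδ zero_lt_one)
  rw [lt_min_iff] at hd'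
  have h3 : ∀ z ∈ Set.Icc 0 d, -φ₃ (1 - z) ∈ Set.Icc (0.99 * -φ₃ 1) (1.01 * -φ₃ 1) :=
    fun z hz => hball (by rw [Real.dist_eq, sub_zero, abs_of_nonneg hz.1]; linarith [hz.2])
  have hsub : ∀ z : ℝ, HasDerivAt (fun z : ℝ => 1 - z) (-1) z := fun z => by
    simpa using (hasDerivAt_id z).const_sub 1
  have h0 : (0 : ℝ) ∈ Set.Icc 0 d := ⟨le_rfl, hd.le⟩
  have h2 : ∀ z ∈ Set.Icc 0 d, φ₂ (1 - z) ≤ 1.01 * -φ₃ 1 * z := fun z hz => by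
    have hder : ∀ z, HasDerivAt (fun z => 1.01 * -φ₃ 1 * z - φ₂ (1 - z))
        (1.01 * -φ₃ 1 + φ₃ (1 - z)) z := fun z => by
      have e := (hφ.hasDerivAt' (1 - z)).comp z (hsub z)
      exact (((hasDerivAt_id z).const_mul (1.01 * -φ₃ 1)).sub e).congr_deriv (by ring)
    have := monotoneOn_of_hasDerivWithinAt_nonneg (convex_Icc 0 d)
      (fun x _ => (hder x).continuousAt.continuousWithinAt)
      (fun x _ => (hder x).hasDerivWithinAt)
      (fun x hx => by linarith [(h3 x (interior_subset hx)).2]) h0 hz hz.1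
    simp only [sub_zero, mul_zero, hφ.one] at this
    linarith
  refine ⟨d, hd, hd'.2, fun z hz => ⟨(h3 z hz).1, ?_, h2 z hz, ?_⟩⟩
  · rcases hz.1.eq_or_lt with rfl | h
    · simp [hφ.one]
    · exact (hφ.pos _ (by linarith [hz.2]) (by linarith)).le
  · have hder : ∀ z, HasDerivAt (fun z => 1.01 * -φ₃ 1 * z ^ 2 + φ₁ (1 - z))
        (2.02 * -φ₃ 1 * z - φ₂ (1 - z)) z := fun z => by
      have e := (hφ.hasDerivAt (1 - z)).comp z (hsub z)
      exact (((hasDerivAt_pow 2 z).const_mul (1.01 * -φ₃ 1)).add e).congr_deriv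
        (by norm_num; ring)
    have := monotoneOn_of_hasDerivWithinAt_nonneg (convex_Icc 0 d)
      (fun x _ => (hder x).continuousAt.continuousWithinAt)
      (fun x _ => (hder x).hasDerivWithinAt) (fun x hx => by
        have hx' := interior_subset hx
        have h4 := h2 x hx'
        have h5 := mul_nonneg (neg_pos.2 hk).le hx'.1
        nlinarith) h0 hz hz.1
    simp only [sub_zero] at this
    linarith

/-- Quantitative positivity of the defect of the parabola `(m / η) (η² - ξ²)`, `m = 3|c|/(4k)`. -/
theorem parabola_defect_bound {a p d k s c ρ r₁ η x m : ℝ} (hk : 0 < k) (hs : 0 ≤ s)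
    (hc : |c| ≤ s) (hr₁ : 0 < r₁) (hρ : r₁ ≤ ρ) (hη : 0 < η) (hηr : 200 * η ≤ r₁)
    (hx : |x| ≤ 1) (hm : m = 3 * s / (4 * k)) (ha : 0.99 * k ≤ a) (hp : 0 ≤ p)
    (hp' : p ≤ 1.01 * k * (m * η * (1 - x ^ 2)))
    (hd : -(1.01 * k * (m * η * (1 - x ^ 2)) ^ 2) ≤ d) :
    s ^ 2 / k * (3.36375 * |x| ^ 2 - 1.5 * |x| - 1.15625) ≤
      a * (-(2 * m * x)) ^ 2 + p * (-(2 * m / η)) + c * -(2 * m * x)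
        + p * -(2 * m * x) / ρ + d / ρ ^ 2 := by
  have hm0 : 0 ≤ m := by rw [hm]; positivity
  have hρ0 : 0 < ρ := hr₁.trans_le hρ
  have hX : |x| ^ 2 = x ^ 2 := sq_abs x
  have hX0 := abs_nonneg x
  have hX1 : x ^ 2 ≤ 1 := by rw [← hX]; nlinarith
  set q := s ^ 2 / k with hq
  have hq0 : 0 ≤ q := by positivity
  have hkm : k * m ^ 2 = 9 / 16 * q := by rw [hm, hq]; field_simp; ring
  have hsm : s * m = 3 / 4 * q := by rw [hm, hq]; field_simp
  have hratio : η / ρ ≤ 1 / 200 := by rw [div_le_iff₀ hρ0]; linarith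
  have hratio0 : 0 ≤ η / ρ := by positivity
  have e1 : 2.2275 * q * x ^ 2 ≤ a * (-(2 * m * x)) ^ 2 := by
    have := mul_le_mul_of_nonneg_right ha (show 0 ≤ (-(2 * m * x)) ^ 2 by positivity)
    have h2 : 0.99 * k * (-(2 * m * x)) ^ 2 = 3.96 * (k * m ^ 2) * x ^ 2 := by ring
    rw [h2, hkm] at this
    linarith
  have e2 : -(1.13625 * q * (1 - x ^ 2)) ≤ p * (-(2 * m / η)) := by
    have := mul_le_mul_of_nonneg_right hp' (show 0 ≤ 2 * m / η by positivity)
    have h2 : 1.01 * k * (m * η * (1 - x ^ 2)) * (2 * m / η)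
        = 2.02 * (k * m ^ 2) * (1 - x ^ 2) := by field_simp; ring
    rw [h2, hkm] at this
    linarith
  have e3 : -(1.5 * q * |x|) ≤ c * -(2 * m * x) := by
    have h1 : |c * (2 * m * x)| ≤ s * (2 * m * |x|) := by
      rw [abs_mul, abs_mul, abs_mul, abs_of_nonneg hm0, abs_two]
      gcongr
    have h2 : s * (2 * m * |x|) = 2 * (s * m) * |x| := by ring
    rw [h2, hsm] at h1
    linarith [(abs_le.1 h1).2]
  have e4 : -(0.006 * q) ≤ p * -(2 * m * x) / ρ := by
    have h1 : p * (2 * m * x) ≤ 1.01 * k * (m * η * 1) * (2 * m * 1) := by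
      calc p * (2 * m * x) ≤ p * (2 * m * 1) := by
            gcongr; exact (le_abs_self x).trans hx
        _ ≤ 1.01 * k * (m * η * 1) * (2 * m * 1) := by
            gcongr
            refine hp'.trans ?_
            gcongr
            nlinarith [sq_nonneg x]
    have h2 : p * -(2 * m * x) / ρ = -(p * (2 * m * x) / ρ) := by ring
    have h3 : p * (2 * m * x) / ρ ≤ 1.01 * k * (m * η * 1) * (2 * m * 1) / ρ := by gcongr
    have h4 : 1.01 * k * (m * η * 1) * (2 * m * 1) / ρ = 2.02 * (k * m ^ 2) * (η / ρ) := by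
      ring
    rw [h4, hkm] at h3
    have h5 := mul_le_mul_of_nonneg_left hratio hq0
    rw [h2]
    linarith
  have e5 : -(0.0001 * q) ≤ d / ρ ^ 2 := by
    have h1 : -(1.01 * k * (m * η * 1) ^ 2) ≤ d := by
      refine le_trans (neg_le_neg ?_) hd
      have : 0 ≤ 1 - x ^ 2 := by linarith
      gcongr
      nlinarith [sq_nonneg x]
    have h2 : -(1.01 * k * (m * η * 1) ^ 2) / ρ ^ 2 ≤ d / ρ ^ 2 := by gcongr
    have h3 : -(1.01 * k * (m * η * 1) ^ 2) / ρ ^ 2 = -(1.01 * (k * m ^ 2) * (η / ρ) ^ 2) := by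
      ring
    rw [h3, hkm] at h2
    have h4 : (η / ρ) ^ 2 ≤ (1 / 200) ^ 2 := by gcongr
    have h5 := mul_le_mul_of_nonneg_left h4 hq0
    linarith
  rw [hX]
  linarith

theorem exists_barrier {φ₁ φ₂ φ₃ : ℝ → ℝ} (hφ : IsForwardBackwardFlux φ₁ φ₂ φ₃)
    {r₁ r₂ c δ : ℝ} (hr₁ : 0 < r₁) (hr₂ : 0 < r₂)
    (hc : c ^ 2 = -φ₃ 1 * φ₁ 1 / (2 * r₂ ^ 2)) (hδ : 0 < δ) :
    ∃ η θ : ℝ, ∃ z z' z'' : ℝ → ℝ, 0 < θ ∧ θ < η ∧ η < δ ∧ IsBump z z' z'' η ∧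
      (∀ ξ, z ξ < δ) ∧
      (∀ ξ, θ ≤ |ξ| → |ξ| ≤ η → ∀ ρ ∈ Set.Ioo r₁ r₂,
        φ₁ 1 / ρ ^ 2 ≤ barrierDefect φ₁ φ₂ φ₃ z z' z'' c ξ ρ) ∧
      ∀ ξ, |ξ| ≤ η → ∀ ρ ∈ Set.Ioo r₁ r₂, 0 < barrierDefect φ₁ φ₂ φ₃ z z' z'' c ξ ρ := by
  obtain ⟨z₀, hz₀, hz₁, htaylor⟩ := hφ.exists_taylor_bounds
  set k := -φ₃ 1 with hkdef
  have hk : 0 < k := neg_pos.2 hφ.one'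
  have hφ1 := hφ.one_pos
  have hc0 : c ≠ 0 := by
    rintro rfl
    have : 0 < k * φ₁ 1 / (2 * r₂ ^ 2) := by positivity
    rw [← hc] at this
    norm_num at this
  set m := 3 * |c| / (4 * k) with hm
  have hm0 : 0 < m := by positivity
  obtain ⟨η, hη, hη'⟩ := exists_between
    (show 0 < min δ (min (r₁ / 200) (min (z₀ / m) (δ / m))) by positivity)
  simp only [lt_min_iff, lt_div_iff₀ hm0] at hη'
  obtain ⟨hηδ, hηr, hηz, hηδ'⟩ := hη'
  set z : ℝ → ℝ := fun ξ => m / η * (η ^ 2 - ξ ^ 2) with hz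
  have hzle : ∀ ξ, z ξ ≤ η * m := fun ξ => by
    have h1 : η * m - z ξ = m / η * ξ ^ 2 := by simp only [hz]; field_simp; ring
    have h2 : 0 ≤ m / η * ξ ^ 2 := by positivity
    linarith
  have key : ∀ ξ, |ξ| ≤ η → ∀ ρ ∈ Set.Ioo r₁ r₂,
      c ^ 2 / k * (3.36375 * |ξ / η| ^ 2 - 1.5 * |ξ / η| - 1.15625) + φ₁ 1 / ρ ^ 2 ≤
        barrierDefect φ₁ φ₂ φ₃ z (fun ξ => -(2 * m * (ξ / η))) (fun _ => -(2 * m / η)) c ξ ρ := by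
    intro ξ hξ ρ hρ
    have hzx : z ξ = m * η * (1 - (ξ / η) ^ 2) := by simp only [hz]; field_simp
    have hx : |ξ / η| ≤ 1 := by
      rw [abs_div, abs_of_pos hη, div_le_one hη]; exact hξ
    have hz0 : 0 ≤ z ξ := by
      have h1 : (ξ / η) ^ 2 ≤ 1 := by rw [← sq_abs]; nlinarith [abs_nonneg (ξ / η)]
      rw [hzx]
      have : 0 ≤ 1 - (ξ / η) ^ 2 := by linarith
      positivity
    obtain ⟨t1, t2, t3, t4⟩ := htaylor (z ξ) ⟨hz0, (hzle ξ).trans hηz.le⟩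
    have := parabola_defect_bound (c := c) (η := η) (x := ξ / η)
      (d := φ₁ (1 - z ξ) - φ₁ 1) hk (abs_nonneg c) le_rfl hr₁ hρ.1.le hη (by linarith) hx hm t1 t2
      (by rw [← hzx]; exact t3) (by rw [← hzx]; exact t4)
    rw [sq_abs] at this
    simp only [barrierDefect]
    rw [sub_div] at this
    linarith
  have hq : 0 < c ^ 2 / k := by positivity
  refine ⟨η, 0.9 * η, z, fun ξ => -(2 * m * (ξ / η)), fun _ => -(2 * m / η), by positivity,
    by linarith, hηδ, ⟨fun ξ => ?_, fun ξ => ?_, ?_, ?_, fun ξ hξ => ?_,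
    fun ξ _ => ?_⟩, fun ξ => ?_, fun ξ hξ hξη ρ hρ => ?_, fun ξ hξ ρ hρ => ?_⟩
  rotate_left 7
  · refine le_trans ?_ (key ξ hξη ρ hρ)
    have hx : 0.9 ≤ |ξ / η| := by
      rwa [abs_div, abs_of_pos hη, le_div_iff₀ hη]
    have : 0 ≤ c ^ 2 / k * (3.36375 * |ξ / η| ^ 2 - 1.5 * |ξ / η| - 1.15625) :=
      mul_nonneg hq.le (by nlinarith)
    linarith
  · refine lt_of_lt_of_le ?_ (key ξ hξ ρ hρ)
    have h1 : 2 * (c ^ 2 / k) = φ₁ 1 / r₂ ^ 2 := by rw [hc]; field_simp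
    have h2 : φ₁ 1 / r₂ ^ 2 < φ₁ 1 / ρ ^ 2 := by
      have := hr₁.trans hρ.1
      have := hρ.2
      gcongr
    have h3 : -(c ^ 2 / k * 2) <
        c ^ 2 / k * (3.36375 * |ξ / η| ^ 2 - 1.5 * |ξ / η| - 1.15625) := by
      rw [← mul_neg]
      exact mul_lt_mul_of_pos_left (by nlinarith [sq_nonneg (|ξ / η| - 0.25)]) hq
    linarith
  · exact (((hasDerivAt_pow 2 ξ).const_sub (η ^ 2)).const_mul (m / η)).congr_deriv
      (by norm_num; ring)
  · exact ((((hasDerivAt_id ξ).div_const η).const_mul (2 * m)).neg).congr_deriv (by ring)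
  · simp [hz]
  · simp [hz]
  · have : 0 < η ^ 2 - ξ ^ 2 := by nlinarith [hξ.1, hξ.2]
    simp only [hz]
    positivity
  · linarith [hzle ξ]
  · linarith [hzle ξ]

namespace IsRadialSolution

open Filter Topology

variable {φ₁ φ₂ φ₃ : ℝ → ℝ} {r₁ r₂ T : ℝ} {u ur ut urr urrr urt : ℝ → ℝ → ℝ}

/-- Subcriticality at a point persists along lines of a suitable small slope. -/
theorem ur_lt_one_along_line (hu : IsRadialSolution φ₁ r₁ r₂ T u ur ut urr urrr urt)
    (hφ : IsForwardBackwardFlux φ₁ φ₂ φ₃) (hr₁ : 0 < r₁) {a b c R₀ t₁ : ℝ}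
    (hc : c ^ 2 = -φ₃ 1 * φ₁ 1 / (2 * r₂ ^ 2)) (ha : r₁ < a) (hb : b < r₂) (ht₁ : t₁ < T)
    (hline : ∀ s ∈ Set.Icc 0 t₁, R₀ + c * s ∈ Set.Icc a b) (h0 : ur R₀ 0 < 1) :
    ∀ s ∈ Set.Icc 0 t₁, ur (R₀ + c * s) s < 1 := by
  intro s hs
  have hline0 : R₀ ∈ Set.Icc a b := by simpa using hline 0 ⟨le_rfl, hs.1.trans hs.2⟩
  have hR₀ : R₀ ∈ Set.Ioo r₁ r₂ := ⟨ha.trans_le hline0.1, hline0.2.trans_lt hb⟩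
  have hT : 0 < T := (hs.1.trans hs.2).trans_lt ht₁
  obtain ⟨δ', hδ', hball⟩ := Metric.eventually_nhds_iff.1
    ((hu.continuousAt_ur hR₀ ⟨le_rfl, hT⟩).eventually
      (gt_mem_nhds (show ur R₀ 0 < (1 + ur R₀ 0) / 2 by linarith)))
  obtain ⟨δ, hδ, hδlt⟩ := exists_between (show
    0 < min δ' (min ((1 - ur R₀ 0) / 2) (min (a - r₁) (r₂ - b))) by
      simp only [lt_min_iff]; refine ⟨hδ', ?_, ?_, ?_⟩ <;> linarith)
  simp only [lt_min_iff] at hδlt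
  obtain ⟨hδ1, hδ2, hδ3, hδ4⟩ := hδlt
  obtain ⟨η, θ, z, z', z'', hθ, hθη, hηδ, hz, hzδ, hbar, hbar'⟩ :=
    exists_barrier hφ hr₁ (hr₁.trans (hR₀.1.trans hR₀.2)) hc hδ
  have key := hu.barrier_le hφ hr₁ hz hθ hθη ht₁ (b := R₀) (fun s hs ξ hξ => ?_) hbar hbar'
    (fun ξ hξ => ?_) s hs 0 ⟨by linarith, by linarith⟩
  · have := hz.pos 0 ⟨by linarith, by linarith⟩
    rw [add_zero] at key
    linarith
  · have := hline s hs
    constructor <;> linarith [this.1, this.2, hξ.1, hξ.2]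
  · have := hball (y := R₀ + ξ) (by
      rw [Real.dist_eq, add_sub_cancel_left]
      exact (abs_le.2 hξ).trans_lt (hηδ.trans hδ1))
    linarith [hzδ ξ]

/-- As long as it stays supercritical and is not attained on the lateral boundary, the maximum of
`u_r` on a shrinking interval decreases at speed at most `φ₁(1) / r₁²`. -/
theorem exists_le_ur (hu : IsRadialSolution φ₁ r₁ r₂ T u ur ut urr urrr urt)
    (hφ : IsForwardBackwardFlux φ₁ φ₂ φ₃) (hr₁ : 0 < r₁) {a b c t₁ r₀ : ℝ} (ha : r₁ < a)
    (hb : b < r₂) (hc : 0 ≤ c) (ht₁ : t₁ < T) (hr₀ : r₀ ∈ Set.Icc a b)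
    (hleft : ∀ s ∈ Set.Icc 0 t₁, ur (a + c * s) s < 1)
    (hright : ∀ s ∈ Set.Icc 0 t₁, ur (b - c * s) s < 1)
    (hlarge : 1 < ur r₀ 0 - φ₁ 1 / r₁ ^ 2 * t₁) :
    ∀ s ∈ Set.Icc 0 t₁, ∃ r ∈ Set.Icc (a + c * s) (b - c * s),
      ur r₀ 0 - φ₁ 1 / r₁ ^ 2 * s ≤ ur r s := by
  have hφ1 := hφ.one_pos
  set L := φ₁ 1 / r₁ ^ 2 with hL
  have hL0 : 0 < L := by positivity
  have hdom : ∀ s ∈ Set.Icc 0 t₁, ∀ r ∈ Set.Icc a b, r ∈ Set.Ioo r₁ r₂ ∧ s ∈ Set.Ico 0 T :=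
    fun s hs r hr => ⟨⟨ha.trans_le hr.1, hr.2.trans_lt hb⟩, hs.1, hs.2.trans_lt ht₁⟩
  refine forall_Icc_of_local_extension ?_ ⟨r₀, by simpa using hr₀, by simp⟩ fun t ht hP => ?_
  · have hC : ContinuousOn (fun p : ℝ × ℝ => ur p.1 p.2) (Set.Icc a b ×ˢ Set.Icc 0 t₁) :=
      hu.continuousOn_ur.mono fun p hp => hdom p.2 hp.2 p.1 hp.1
    have hcl := (isClosed_Icc.prod isClosed_Icc).isClosed_le
      (s := Set.Icc a b ×ˢ Set.Icc 0 t₁) (f := fun p : ℝ × ℝ => ur r₀ 0 - L * p.2)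
      (by fun_prop) hC
    have hcl2 : IsClosed ({p : ℝ × ℝ | a + c * p.2 ≤ p.1} ∩ {p | p.1 ≤ b - c * p.2}) :=
      (isClosed_le (by fun_prop) (by fun_prop)).inter (isClosed_le (by fun_prop) (by fun_prop))
    have hcomp := (((isCompact_Icc.prod isCompact_Icc).of_isClosed_subset (hcl.inter hcl2)
      fun p hp => hp.1.1).image continuous_snd).isClosed
    convert hcomp using 1
    ext t
    constructor
    · rintro ⟨ht, r, hr, hle⟩
      have := mul_nonneg hc ht.1
      exact ⟨(r, t), ⟨⟨⟨⟨by linarith [hr.1], by linarith [hr.2]⟩, ht⟩, hle⟩, hr⟩, rfl⟩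
    · rintro ⟨⟨r, s⟩, ⟨⟨hp, hle⟩, hr⟩, rfl⟩
      exact ⟨hp.2, r, hr, hle⟩
  have htI : t ∈ Set.Icc 0 t₁ := ⟨ht.1, ht.2.le⟩
  have hct := mul_nonneg hc ht.1
  have hsub : ∀ r ∈ Set.Icc (a + c * t) (b - c * t), r ∈ Set.Icc a b := fun r hr =>
    ⟨by linarith [hr.1], by linarith [hr.2]⟩
  obtain ⟨r, hr, hle⟩ := hP t ⟨ht.1, le_rfl⟩
  obtain ⟨ρ, hρ, hmax⟩ := isCompact_Icc.exists_isMaxOn ⟨r, hr⟩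
    (f := fun r => ur r t) fun r hr =>
      (hu.continuousAt_ur (hdom t htI r (hsub r hr)).1 (hdom t htI r (hsub r hr)).2)
        |>.continuousWithinAt
  obtain ⟨hρD, htD⟩ := hdom t htI ρ (hsub ρ hρ)
  have hge : ur r₀ 0 - L * t ≤ ur ρ t := hle.trans (hmax hr)
  have hv : 1 < ur ρ t := by
    have := mul_lt_mul_of_pos_left ht.2 hL0
    linarith
  have hvne : |ur ρ t| ≠ 1 := by rw [abs_of_pos (by linarith)]; linarith
  have hρI : ρ ∈ Set.Ioo (a + c * t) (b - c * t) := by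
    refine ⟨lt_of_le_of_ne hρ.1 ?_, lt_of_le_of_ne hρ.2 ?_⟩
    · rintro rfl
      linarith [hleft t htI]
    · rintro rfl
      linarith [hright t htI]
  have hloc : IsLocalMax (fun r => ur r t) ρ := hmax.isLocalMax (Icc_mem_nhds hρI.1 hρI.2)
  have hder : ∀ᶠ r in 𝓝 ρ, HasDerivAt (fun r => ur r t) (urr r t) r := by
    filter_upwards [Ioo_mem_nhds hρD.1 hρD.2,
      (hu.continuousAt_ur hρD htD).abs.eventually_ne hvne] with r h1 h2
    exact hu.hasDerivAt_ur r t h1 htD h2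
  have e1 := hloc.hasDerivAt_eq_zero hder.self_of_nhds
  have e2 := hloc.nonpos_of_hasDerivAt_deriv hder (hu.hasDerivAt_urr ρ t hρD htD hvne)
  have e3 := hu.urt_eq hφ hr₁ hρD htD hvne
  have e4 : -L < urt ρ t := by
    have h1 : φ₁ (ur ρ t) / ρ ^ 2 ≤ φ₁ 1 / ρ ^ 2 := by
      gcongr
      exact hφ.le_one (by linarith)
    have h2 : φ₁ 1 / ρ ^ 2 < L := by
      have := hρD.1
      rw [hL]
      gcongr
    have h3 := mul_nonneg_of_nonpos_of_nonpos (hφ.neg _ hv).le e2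
    rw [e3, e1]
    simp only [mul_zero, ne_eq, OfNat.ofNat_ne_zero, not_false_eq_true, zero_pow, zero_div]
    linarith
  have e5 : HasDerivWithinAt (fun s => ur ρ s + L * s) (urt ρ t + L) (Set.Ioi t) t :=
    (((hu.hasDerivWithinAt_ur ρ t hρD htD hvne).mono_of_mem_nhdsWithin
      (Ico_mem_nhdsGT_of_mem htD)).add ((hasDerivAt_id t).const_mul L).hasDerivWithinAt).congr_deriv
        (by ring)
  rw [hasDerivWithinAt_iff_tendsto_slope' (by simp)] at e5
  have e6 : ∀ᶠ s in 𝓝[>] t, a + c * s < ρ ∧ ρ < b - c * s := by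
    refine eventually_nhdsWithin_of_eventually_nhds (Filter.Eventually.and ?_ ?_)
    · exact ContinuousAt.eventually_lt (by fun_prop) continuousAt_const hρI.1
    · exact ContinuousAt.eventually_lt continuousAt_const (by fun_prop) hρI.2
  obtain ⟨h, hh, hIoc⟩ := mem_nhdsGT_iff_exists_Ioc_subset.1
    ((e5.eventually (lt_mem_nhds (show 0 < urt ρ t + L by linarith))).and e6)
  refine ⟨h, hh, fun s hs _ => ?_⟩
  rcases hs.1.eq_or_lt with rfl | hts
  · exact ⟨r, hr, hle⟩
  obtain ⟨h1, h2, h3⟩ := hIoc ⟨hts, hs.2⟩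
  refine ⟨ρ, ⟨h2.le, h3.le⟩, ?_⟩
  rw [slope_def_field, div_pos_iff_of_pos_right (sub_pos.2 hts)] at h1
  linarith

/-- Upper bound for the lifespan of solutions with a large gradient between two subcritical
points. -/
theorem lifespan_le (hu : IsRadialSolution φ₁ r₁ r₂ T u ur ut urr urrr urt)
    (hφ : IsForwardBackwardFlux φ₁ φ₂ φ₃) (hr₁ : 0 < r₁) {a b r₀ : ℝ} (ha : r₁ < a)
    (har₀ : a ≤ r₀) (hr₀b : r₀ ≤ b) (hb : b < r₂) (hura : ur a 0 < 1) (hurb : ur b 0 < 1)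
    (hlarge : 1 + r₂ * (r₂ - r₁) / r₁ ^ 2 * Real.sqrt (φ₁ 1 / (2 * -φ₃ 1)) < ur r₀ 0) :
    T ≤ r₂ * (r₂ - r₁) / Real.sqrt (2 * φ₁ 1 * -φ₃ 1) := by
  have hφ1 := hφ.one_pos
  have hk : 0 < -φ₃ 1 := neg_pos.2 hφ.one'
  have hr₂ : 0 < r₂ := by linarith
  by_contra! hT
  set S := Real.sqrt (2 * φ₁ 1 * -φ₃ 1) with hS
  have hS0 : 0 < S := Real.sqrt_pos.2 (by positivity)
  have hS2 : S ^ 2 = 2 * φ₁ 1 * -φ₃ 1 := Real.sq_sqrt (by positivity)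
  set c := S / (2 * r₂) with hc
  have hc0 : 0 < c := by positivity
  have hc2 : c ^ 2 = -φ₃ 1 * φ₁ 1 / (2 * r₂ ^ 2) := by
    rw [hc, div_pow, hS2]
    field_simp
  set t₁ := (b - a) / (2 * c) with ht₁
  have ht₁0 : 0 ≤ t₁ := div_nonneg (by linarith) (by positivity)
  have hct₁ : 2 * (c * t₁) = b - a := by rw [ht₁]; field_simp
  have hmeet : a + c * t₁ = b - c * t₁ := by linarith
  have ht₁le : t₁ ≤ r₂ * (r₂ - r₁) / S := by
    have h1 : t₁ = r₂ * (b - a) / S := by rw [ht₁, hc]; field_simp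
    rw [h1]
    gcongr
  have hsqrt : Real.sqrt (φ₁ 1 / (2 * -φ₃ 1)) = φ₁ 1 / S := by
    rw [Real.sqrt_eq_iff_mul_self_eq_of_pos (by positivity), ← sq, div_pow, hS2]
    field_simp
  have hlarge' : 1 < ur r₀ 0 - φ₁ 1 / r₁ ^ 2 * t₁ := by
    have h1 : φ₁ 1 / r₁ ^ 2 * t₁ ≤ φ₁ 1 / r₁ ^ 2 * (r₂ * (r₂ - r₁) / S) := by gcongr
    have h2 : φ₁ 1 / r₁ ^ 2 * (r₂ * (r₂ - r₁) / S) = r₂ * (r₂ - r₁) / r₁ ^ 2 * (φ₁ 1 / S) := by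
      ring
    rw [hsqrt] at hlarge
    linarith
  have hcs : ∀ s ∈ Set.Icc 0 t₁, 0 ≤ c * s ∧ c * s ≤ c * t₁ := fun s hs =>
    ⟨mul_nonneg hc0.le hs.1, mul_le_mul_of_nonneg_left hs.2 hc0.le⟩
  have hleft := hu.ur_lt_one_along_line hφ hr₁ hc2 ha hb (ht₁le.trans_lt hT)
    (fun s hs => ⟨by linarith [hcs s hs], by linarith [hcs s hs]⟩) hura
  have hright := hu.ur_lt_one_along_line hφ hr₁ (c := -c) (by rw [neg_sq]; exact hc2) ha hb
    (ht₁le.trans_lt hT) (fun s hs => ⟨by linarith [hcs s hs], by linarith [hcs s hs]⟩) hurb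
  obtain ⟨r, hr, hle⟩ := hu.exists_le_ur hφ hr₁ ha hb hc0.le (ht₁le.trans_lt hT) ⟨har₀, hr₀b⟩
    hleft (fun s hs => by simpa [sub_eq_add_neg] using hright s hs) hlarge' t₁ ⟨ht₁0, le_rfl⟩
  have hreq : r = a + c * t₁ := le_antisymm (hr.2.trans hmeet.ge) hr.1
  rw [hreq] at hle
  linarith [hleft t₁ ⟨ht₁0, le_rfl⟩]

end IsRadialSolution

theorem isForwardBackwardFlux_deriv {φ : ℝ → ℝ} (hφ : ContDiff ℝ (⊤ : ℕ∞) φ)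
    (hφeven : ∀ σ : ℝ, φ (-σ) = φ σ)
    (hφ2pos : ∀ σ : ℝ, 0 ≤ σ → σ < 1 → 0 < deriv (deriv φ) σ)
    (hφ2one : deriv (deriv φ) 1 = 0)
    (hφ2neg : ∀ σ : ℝ, 1 < σ → deriv (deriv φ) σ < 0)
    (hφ3neg : deriv (deriv (deriv φ)) 1 < 0) :
    IsForwardBackwardFlux (deriv φ) (deriv (deriv φ)) (deriv (deriv (deriv φ))) := by
  have h1 : ContDiff ℝ (⊤ : ℕ∞) (deriv φ) := (contDiff_infty_iff_deriv.1 hφ).2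
  have h2 : ContDiff ℝ (⊤ : ℕ∞) (deriv (deriv φ)) := (contDiff_infty_iff_deriv.1 h1).2
  have h3 := contDiff_infty_iff_deriv.1 h2
  refine ⟨fun v => ((contDiff_infty_iff_deriv.1 h1).1 v).hasDerivAt, fun v => (h3.1 v).hasDerivAt,
    h3.2.continuous, ?_, hφ2pos, hφ2one, hφ2neg, hφ3neg⟩
  have h := deriv_comp_neg φ 0
  simp only [hφeven, neg_zero] at h
  linarith

/-- Theorem 1.3 / `thm:no-ex`.
Nonexistence of global-in-time `C¹` radial solutions with large enough gradient:
if a `C¹` solution of the radial equation `u_t = (φ'(u_r))_r + φ'(u_r)/r` on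
`(r₁,r₂)×[0,T)` has an initial datum which is subcritical at `r₃` and `r₅` and
satisfies `u_r(r₄,0) > 1 + (r₂(r₂-r₁)/r₁²)√(φ'(1)/(2|φ'''(1)|))`, and if `u` is of
class `C³` in `r` with continuous mixed derivative `u_{rt}` on the open set where
`|u_r| ≠ 1` (interior parabolic regularity), then
`T ≤ r₂(r₂-r₁)/√(2 φ'(1) |φ'''(1)|)`. -/
theorem no_global_radial_solution_large_gradient
    (φ : ℝ → ℝ) (hφ : ContDiff ℝ (⊤ : ℕ∞) φ) (hφeven : ∀ σ : ℝ, φ (-σ) = φ σ)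
    (hφ2pos : ∀ σ : ℝ, 0 ≤ σ → σ < 1 → 0 < deriv (deriv φ) σ)
    (hφ2one : deriv (deriv φ) 1 = 0)
    (hφ2neg : ∀ σ : ℝ, 1 < σ → deriv (deriv φ) σ < 0)
    (hφ3neg : deriv (deriv (deriv φ)) 1 < 0)
    (r₁ r₂ r₃ r₄ r₅ T : ℝ)
    (hr₁ : 0 < r₁) (h13 : r₁ < r₃) (h34 : r₃ < r₄) (h45 : r₄ < r₅) (h52 : r₅ < r₂)
    (hT : 0 < T)
    (u ur ut urr urrr urt : ℝ → ℝ → ℝ)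
    -- `u` is of class `C¹` on `(r₁,r₂)×[0,T)`: the partial derivatives exist ...
    (hur : ∀ r t : ℝ, r ∈ Set.Ioo r₁ r₂ → t ∈ Set.Ico 0 T →
      HasDerivAt (fun ρ => u ρ t) (ur r t) r)
    (hut : ∀ r t : ℝ, r ∈ Set.Ioo r₁ r₂ → t ∈ Set.Ico 0 T →
      HasDerivWithinAt (fun s => u r s) (ut r t) (Set.Ico 0 T) t)
    -- ... and `u`, `u_r`, `u_t` are continuous on `(r₁,r₂)×[0,T)`
    (huC : ContinuousOn (fun p : ℝ × ℝ => u p.1 p.2) (Set.Ioo r₁ r₂ ×ˢ Set.Ico 0 T))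
    (hurC : ContinuousOn (fun p : ℝ × ℝ => ur p.1 p.2) (Set.Ioo r₁ r₂ ×ˢ Set.Ico 0 T))
    (hutC : ContinuousOn (fun p : ℝ × ℝ => ut p.1 p.2) (Set.Ioo r₁ r₂ ×ˢ Set.Ico 0 T))
    -- the radial equation `u_t = (φ'(u_r))_r + φ'(u_r)/r`
    (heq : ∀ r t : ℝ, r ∈ Set.Ioo r₁ r₂ → t ∈ Set.Ico 0 T →
      HasDerivAt (fun ρ => deriv φ (ur ρ t)) (ut r t - deriv φ (ur r t) / r) r)
    -- `u` is of class `C³` in `r` on the set where `|u_r| ≠ 1` ...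
    (hurr : ∀ r t : ℝ, r ∈ Set.Ioo r₁ r₂ → t ∈ Set.Ico 0 T → |ur r t| ≠ 1 →
      HasDerivAt (fun ρ => ur ρ t) (urr r t) r)
    (hurrr : ∀ r t : ℝ, r ∈ Set.Ioo r₁ r₂ → t ∈ Set.Ico 0 T → |ur r t| ≠ 1 →
      HasDerivAt (fun ρ => urr ρ t) (urrr r t) r)
    -- ... with existing, continuous mixed derivative `u_{rt}` there
    (hurt : ∀ r t : ℝ, r ∈ Set.Ioo r₁ r₂ → t ∈ Set.Ico 0 T → |ur r t| ≠ 1 →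
      HasDerivWithinAt (fun s => ur r s) (urt r t) (Set.Ico 0 T) t)
    (hurrC : ContinuousOn (fun p : ℝ × ℝ => urr p.1 p.2)
      {p : ℝ × ℝ | p.1 ∈ Set.Ioo r₁ r₂ ∧ p.2 ∈ Set.Ico 0 T ∧ |ur p.1 p.2| ≠ 1})
    (hurrrC : ContinuousOn (fun p : ℝ × ℝ => urrr p.1 p.2)
      {p : ℝ × ℝ | p.1 ∈ Set.Ioo r₁ r₂ ∧ p.2 ∈ Set.Ico 0 T ∧ |ur p.1 p.2| ≠ 1})
    (hurtC : ContinuousOn (fun p : ℝ × ℝ => urt p.1 p.2)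
      {p : ℝ × ℝ | p.1 ∈ Set.Ioo r₁ r₂ ∧ p.2 ∈ Set.Ico 0 T ∧ |ur p.1 p.2| ≠ 1})
    -- the initial datum: subcritical at `r₃` and `r₅`, large at `r₄`
    (hinit₃ : |ur r₃ 0| < 1) (hinit₅ : |ur r₅ 0| < 1)
    (hinit₄ : ur r₄ 0 >
      1 + r₂ * (r₂ - r₁) / r₁ ^ 2 *
        Real.sqrt (deriv φ 1 / (2 * |deriv (deriv (deriv φ)) 1|))) :
    T ≤ r₂ * (r₂ - r₁) / Real.sqrt (2 * deriv φ 1 * |deriv (deriv (deriv φ)) 1|) := by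
  have hφ' := isForwardBackwardFlux_deriv hφ hφeven hφ2pos hφ2one hφ2neg hφ3neg
  have hu : IsRadialSolution (deriv φ) r₁ r₂ T u ur ut urr urrr urt :=
    ⟨hur, hut, huC, hurC, hutC, heq, hurr, hurrr, hurt, hurrC, hurrrC, hurtC⟩
  rw [abs_of_neg hφ3neg] at hinit₄ ⊢
  exact hu.lifespan_le hφ' hr₁ h13 h34.le h45.le h52 (abs_lt.1 hinit₃).2 (abs_lt.1 hinit₅).2 hinit₄
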